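/- arXiv:2604.24650 — 4 statements merged into one kernel-verified Lean document; each statement's English description precedes it below -/
import Mathlib

section
/- Let k ≥ 3 be either 4 or a prime, and let 1 < a < b < c be integers with a^k < b < c such that a^k·b + 1 = r^k, a^k·c + 1 = s^k, and b·c + 1 = t^k for positive integers r, s, t. With N := a^k·b, μ_k := Π_{p prime, p ∣ k} p^{1/(p−1)}, and λ := 1 + log(k·μ_k·(√N + √(N+1))^2) / log((1/(k·μ_k))·(√N + √(N+1))^2), one has (a^k·c)^{k−λ} < 8^k·μ_k^k·(a^k·b)^{k+λ}, where real exponents denote real powers and log is the natural logarithm. -/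
open Finset in
lemma bk_fact_mul_choose (x : ℝ) (m : ℕ) :
    (m.factorial : ℝ) * Ring.choose x m = ∏ l ∈ range m, (x - l) := by
  have h := Ring.descPochhammer_eq_factorial_smul_choose x m
  rw [nsmul_eq_mul] at h
  rw [← h]
  clear h
  induction m with
  | zero => simp
  | succ m ih =>
    rw [prod_range_succ, ← ih, descPochhammer_succ_right, Polynomial.smeval_mul]
    simp [Polynomial.smeval_sub, Polynomial.smeval_natCast]

open Finset in
lemma bk_partial (n : ℕ) : ∀ z : ℝ, (∀ j : ℤ, z ≠ j) →
    ∑ j ∈ range (n + 1), (-1 : ℝ) ^ j * (n.choose j : ℝ) / (z - j) =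
      (-1) ^ n * n.factorial / ∏ j ∈ range (n + 1), (z - j) := by
  induction n with
  | zero => intro z hz; simp
  | succ n ih =>
    intro z hz
    have hz1 : ∀ j : ℤ, z - 1 ≠ j := by
      intro j h
      apply hz (j + 1)
      push_cast
      linarith
    have e1 : ∑ j ∈ range (n + 1 + 1), (-1 : ℝ) ^ j * ((n + 1).choose j : ℝ) / (z - j) =
        ∑ j ∈ range (n + 1), (-1 : ℝ) ^ j * (n.choose j : ℝ) / (z - j)
        - ∑ j ∈ range (n + 1), (-1 : ℝ) ^ j * (n.choose j : ℝ) / (z - 1 - j) := by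
      have e2 : ∑ j ∈ range (n + 1), (-1 : ℝ) ^ j * (n.choose j : ℝ) / (z - j) =
          ∑ j ∈ range (n + 1 + 1), (-1 : ℝ) ^ j * (n.choose j : ℝ) / (z - j) := by
        rw [sum_range_succ _ (n + 1)]
        simp
      rw [e2, sum_range_succ' _ (n + 1), sum_range_succ' _ (n + 1)]
      simp only [Nat.choose_succ_succ]
      rw [add_sub_right_comm, ← sum_sub_distrib]
      congr 1
      · apply sum_congr rfl
        intro j _
        push_cast
        rw [show z - ((j : ℝ) + 1) = z - 1 - j by ring]
        ring
      · simp
    rw [e1, ih z hz, ih (z - 1) hz1]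
    have hp : ∏ j ∈ range n, (z - 1 - (j : ℝ)) ≠ 0 := by
      rw [prod_ne_zero_iff]
      intro j _ h
      exact hz1 j (by push_cast; linarith)
    have f1 : ∏ j ∈ range (n + 1), (z - (j : ℝ)) = (∏ j ∈ range n, (z - 1 - (j : ℝ))) * z := by
      rw [prod_range_succ']
      congr 1
      · apply prod_congr rfl
        intro j _
        push_cast; ring
      · simp
    have f2 : ∏ j ∈ range (n + 1 + 1), (z - (j : ℝ)) =
        (∏ j ∈ range n, (z - 1 - (j : ℝ))) * z * (z - 1 - n) := by
      rw [prod_range_succ, f1]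
      push_cast; ring
    rw [f1, f2, prod_range_succ]
    have g0 : z ≠ 0 := by simpa using hz 0
    have g1 : z - 1 - n ≠ 0 := by
      intro h
      exact hz1 n (by push_cast; linarith)
    rw [Nat.factorial_succ]
    push_cast
    field_simp
    ring

/-- the normalising constant of the remainder -/
noncomputable def bkC (n : ℕ) (v : ℝ) : ℝ :=
  v * (∏ l ∈ Finset.range n, ((l + 1 + v) * (l + 1 - v))) / (n.factorial : ℝ) ^ 2

lemma bkC_neg (n : ℕ) (v : ℝ) : bkC n (-v) = - bkC n v := by
  unfold bkC
  have : ∏ l ∈ Finset.range n, (((l : ℝ) + 1 + -v) * (l + 1 - -v)) =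
      ∏ l ∈ Finset.range n, (((l : ℝ) + 1 + v) * (l + 1 - v)) := by
    apply Finset.prod_congr rfl
    intro l _
    ring
  rw [this]; ring

open Finset in
lemma bk_coeff (n i : ℕ) (hi : i ≤ n) (v : ℝ) (hv : ∀ j : ℤ, v ≠ j) :
    bkC n v * ((-1) ^ i * (n.choose i : ℝ) *
      ∑ j ∈ range (n + 1), (-1 : ℝ) ^ j * (n.choose j : ℝ) / (v + i - j)) =
    Ring.choose ((n : ℝ) + v) (n - i) * Ring.choose ((n : ℝ) - v) i := by
  obtain ⟨m, rfl⟩ := Nat.exists_eq_add_of_le hi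
  have hvi : ∀ j : ℤ, v + i ≠ j := by
    intro j h
    exact hv (j - i) (by push_cast; linarith)
  rw [bk_partial _ _ hvi]
  have a1 := bk_fact_mul_choose (((i + m : ℕ) : ℝ) + v) m
  have a2 := bk_fact_mul_choose (((i + m : ℕ) : ℝ) - v) i
  rw [Nat.add_sub_cancel_left]
  have hne : ∏ j ∈ range (i + m + 1), (v + i - (j : ℝ)) ≠ 0 := by
    rw [prod_ne_zero_iff]
    intro j _ h
    exact hvi j (by push_cast; linarith)
  have key : v * (∏ l ∈ range (i + m), (((l : ℝ) + 1 + v) * (l + 1 - v))) * (-1) ^ m =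
      (∏ j ∈ range (i + m + 1), (v + i - (j : ℝ))) *
      (∏ l ∈ range m, (((i + m : ℕ) : ℝ) + v - l)) *
      (∏ l ∈ range i, (((i + m : ℕ) : ℝ) - v - l)) := by
    have b1 : ∏ l ∈ range m, (((i + m : ℕ) : ℝ) + v - l) =
        ∏ l ∈ range m, (((i + l : ℕ) : ℝ) + 1 + v) := by
      rw [← prod_range_reflect]
      apply prod_congr rfl
      intro l hl
      have := mem_range.1 hl
      rw [Nat.cast_sub (by omega), Nat.cast_sub (by omega)]
      push_cast; ring
    have b2 : ∏ l ∈ range i, (((i + m : ℕ) : ℝ) - v - l) =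
        ∏ l ∈ range i, (((m + l : ℕ) : ℝ) + 1 - v) := by
      rw [← prod_range_reflect]
      apply prod_congr rfl
      intro l hl
      have := mem_range.1 hl
      rw [Nat.cast_sub (by omega), Nat.cast_sub (by omega)]
      push_cast; ring
    have b3 : ∏ j ∈ range (i + m + 1), (v + i - (j : ℝ)) =
        (∏ l ∈ range i, ((l : ℝ) + 1 + v)) * (v * ((-1) ^ m * ∏ l ∈ range m, ((l : ℝ) + 1 - v))) := by
      rw [add_assoc, prod_range_add, prod_range_succ']
      congr 1
      · rw [← prod_range_reflect]
        apply prod_congr rfl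
        intro l hl
        have := mem_range.1 hl
        rw [Nat.cast_sub (by omega), Nat.cast_sub (by omega)]
        push_cast; ring
      · have : ∏ l ∈ range m, (v + i - ((i + (l + 1) : ℕ) : ℝ)) =
            ∏ l ∈ range m, ((-1) * ((l : ℝ) + 1 - v)) := by
          apply prod_congr rfl
          intro l _
          push_cast; ring
        rw [this, prod_mul_distrib]
        simp
        ring
    rw [b1, b2, b3, prod_mul_distrib, prod_range_add]
    rw [show i + m = m + i from add_comm _ _, prod_range_add (fun l : ℕ => ((l : ℝ) + 1 - v))]
    ring
  rw [← a1, ← a2] at key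
  unfold bkC
  have hc : ((i + m).choose i : ℝ) * i.factorial * m.factorial = (i + m).factorial := by
    have := Nat.choose_mul_factorial_mul_factorial (Nat.le_add_right i m)
    rw [Nat.add_sub_cancel_left] at this
    exact_mod_cast this
  have hsq : ((-1 : ℝ) ^ i) ^ 2 = 1 := by rw [← pow_mul, mul_comm, pow_mul]; simp
  have h1 : ((i + m).factorial : ℝ) ≠ 0 := by positivity
  have h2 : (i.factorial : ℝ) ≠ 0 := by positivity
  have h3 : (m.factorial : ℝ) ≠ 0 := by positivity
  set F : ℝ := ((i + m).factorial : ℝ) with hF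
  set W := ∏ j ∈ range (i + m + 1), (v + i - (j : ℝ)) with hW
  set T := v * (∏ l ∈ range (i + m), (((l : ℝ) + 1 + v) * (l + 1 - v))) with hT
  rw [pow_add]
  field_simp
  have : T * (-1) ^ m * (((-1 : ℝ) ^ i) ^ 2) * ((i + m).choose i : ℝ) * i.factorial * m.factorial =
     F * W * i.factorial * m.factorial * (Ring.choose (((i + m : ℕ) : ℝ) + v) m * Ring.choose (((i + m : ℕ) : ℝ) - v) i) := by
    rw [hsq, key, ← hc]; ring
  apply mul_right_cancel₀ h2
  apply mul_right_cancel₀ h3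
  linear_combination this

lemma bk_not_int {v : ℝ} (h0 : 0 < v) (h1 : v < 1) : ∀ j : ℤ, v ≠ j := by
  rintro j rfl
  have a : 0 < j := by exact_mod_cast h0
  have b : j < 1 := by exact_mod_cast h1
  omega

open Finset in
lemma bk_integral (n : ℕ) (v y : ℝ) (hy : 1 ≤ y) (hv : ∀ j : ℤ, v ≠ j) :
    ∫ u in (1 : ℝ)..y, (u - 1) ^ n * (y - u) ^ n * u ^ (v - n - 1) =
    ∑ i ∈ range (n + 1), ∑ j ∈ range (n + 1),
      ((-1) ^ i * (n.choose i : ℝ)) * ((-1) ^ j * (n.choose j : ℝ)) *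
        (y ^ v * y ^ i - y ^ j) / (v + i - j) := by
  have hpos : ∀ u ∈ Set.uIcc (1 : ℝ) y, 0 < u := by
    intro u hu
    rw [Set.uIcc_of_le hy] at hu
    linarith [hu.1]
  have h0 : (0 : ℝ) ∉ Set.uIcc (1 : ℝ) y := fun h => lt_irrefl _ (hpos 0 h)
  have e1 : ∫ u in (1 : ℝ)..y, (u - 1) ^ n * (y - u) ^ n * u ^ (v - n - 1) =
      ∫ u in (1 : ℝ)..y, ∑ i ∈ range (n + 1), ∑ j ∈ range (n + 1),
      ((-1) ^ i * (n.choose i : ℝ)) * ((-1) ^ j * (n.choose j : ℝ)) * y ^ j *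
        u ^ (v + i - j - 1) := by
    apply intervalIntegral.integral_congr
    intro u hu
    have hu0 := hpos u hu
    simp only
    rw [sub_eq_add_neg u 1, add_pow, sub_eq_add_neg y u, add_pow, sum_mul_sum, sum_mul]
    apply sum_congr rfl
    intro i hi
    rw [sum_mul]
    apply sum_congr rfl
    intro j hj
    have hi' := mem_range_succ_iff.1 hi
    have hj' := mem_range_succ_iff.1 hj
    have s1 : (-1 : ℝ) ^ (n - i) = (-1) ^ n * (-1) ^ i := by
      obtain ⟨m, rfl⟩ := Nat.exists_eq_add_of_le hi'
      rw [Nat.add_sub_cancel_left, pow_add]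
      have : ((-1 : ℝ) ^ i) * (-1) ^ i = 1 := by rw [← mul_pow]; simp
      linear_combination (-(-1 : ℝ) ^ m) * this
    have s2 : (-1 : ℝ) ^ (n - j) = (-1) ^ n * (-1) ^ j := by
      obtain ⟨m, rfl⟩ := Nat.exists_eq_add_of_le hj'
      rw [Nat.add_sub_cancel_left, pow_add]
      have : ((-1 : ℝ) ^ j) * (-1) ^ j = 1 := by rw [← mul_pow]; simp
      linear_combination (-(-1 : ℝ) ^ m) * this
    have s3 : (-u) ^ (n - j) = (-1) ^ n * (-1) ^ j * u ^ (n - j) := by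
      rw [neg_pow, s2]
    have s4 : ((-1 : ℝ) ^ n) * (-1) ^ n = 1 := by rw [← mul_pow]; simp
    have s5 : u ^ (v + i - j - 1) = u ^ i * u ^ (n - j) * u ^ (v - n - 1) := by
      rw [← Real.rpow_natCast, ← Real.rpow_natCast, ← Real.rpow_add hu0, ← Real.rpow_add hu0,
        Nat.cast_sub hj']
      congr 1; ring
    rw [s1, s3, s5]
    linear_combination (u ^ i * (-1) ^ i * (n.choose i : ℝ) * (y ^ j * ((-1) ^ j * u ^ (n - j)) * (n.choose j : ℝ)) * u ^ (v - n - 1)) * s4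
  have hint : ∀ r : ℝ, IntervalIntegrable (fun u : ℝ => u ^ r) MeasureTheory.volume 1 y :=
    fun r => intervalIntegral.intervalIntegrable_rpow (Or.inr h0)
  rw [e1, intervalIntegral.integral_finsetSum]
  · apply sum_congr rfl
    intro i hi
    rw [intervalIntegral.integral_finsetSum]
    · apply sum_congr rfl
      intro j hj
      have hne : v + i - j ≠ 0 := by
        intro h
        exact hv (j - i) (by push_cast; linarith)
      rw [intervalIntegral.integral_const_mul, integral_rpow]
      · rw [sub_add_cancel, Real.one_rpow]
        have hy0 : 0 < y := by linarith
        have : y ^ (v + i - j) = y ^ v * y ^ i / y ^ j := by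
          rw [Real.rpow_sub hy0, Real.rpow_add hy0, Real.rpow_natCast, Real.rpow_natCast]
        rw [this]
        field_simp
      · right
        refine ⟨?_, h0⟩
        intro h
        apply hne
        linarith
    · intro j _
      exact (hint _).const_mul _
  · intro i _
    rw [← Finset.sum_fn]
    apply IntervalIntegrable.sum
    intro j _
    exact (hint _).const_mul _

open Finset in
lemma bk_pade (n : ℕ) (v y : ℝ) (hy : 1 ≤ y) (hv : ∀ j : ℤ, v ≠ j) :
    bkC n v * ∫ u in (1 : ℝ)..y, (u - 1) ^ n * (y - u) ^ n * u ^ (v - n - 1) =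
    y ^ v * ∑ i ∈ range (n + 1),
      Ring.choose ((n : ℝ) + v) (n - i) * Ring.choose ((n : ℝ) - v) i * y ^ i
    - ∑ i ∈ range (n + 1),
      Ring.choose ((n : ℝ) - v) (n - i) * Ring.choose ((n : ℝ) + v) i * y ^ i := by
  rw [bk_integral n v y hy hv]
  have hv' : ∀ j : ℤ, -v ≠ j := by
    intro j h
    exact hv (-j) (by push_cast; linarith)
  have q1 : ∀ i ∈ range (n + 1),
      Ring.choose ((n : ℝ) + v) (n - i) * Ring.choose ((n : ℝ) - v) i * y ^ i =
      bkC n v * ∑ j ∈ range (n + 1), ((-1) ^ i * (n.choose i : ℝ)) * ((-1) ^ j * (n.choose j : ℝ)) *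
        (y ^ i) / (v + i - j) := by
    intro i hi
    rw [← bk_coeff n i (mem_range_succ_iff.1 hi) v hv, mul_assoc, mul_assoc, sum_mul, mul_sum]
    congr 1
    apply sum_congr rfl
    intro j _
    ring
  have q2 : ∀ i ∈ range (n + 1),
      Ring.choose ((n : ℝ) - v) (n - i) * Ring.choose ((n : ℝ) + v) i * y ^ i =
      bkC n v * ∑ j ∈ range (n + 1), ((-1) ^ i * (n.choose i : ℝ)) * ((-1) ^ j * (n.choose j : ℝ)) *
        (y ^ i) / (v + j - i) := by
    intro i hi
    have := bk_coeff n i (mem_range_succ_iff.1 hi) (-v) hv'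
    rw [sub_neg_eq_add, ← sub_eq_add_neg] at this
    rw [← this, bkC_neg, mul_assoc, mul_assoc, sum_mul, mul_sum, neg_mul, ← mul_neg]
    congr 1
    rw [← sum_neg_distrib]
    apply sum_congr rfl
    intro j _
    rw [show v + j - i = -(-v + i - j) by ring, div_neg]
    ring
  rw [sum_congr rfl q1, sum_congr rfl q2, ← mul_sum, ← mul_sum]
  rw [sum_comm (f := fun i j => ((-1) ^ i * (n.choose i : ℝ)) * ((-1) ^ j * (n.choose j : ℝ)) *
        (y ^ i) / (v + j - i))]
  rw [mul_left_comm, ← mul_sub]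
  congr 1
  rw [mul_sum, ← sum_sub_distrib]
  apply sum_congr rfl
  intro i _
  rw [mul_sum, ← sum_sub_distrib]
  apply sum_congr rfl
  intro j _
  ring

open Finset in
lemma bkC_bound (n : ℕ) (v : ℝ) (h0 : 0 < v) (h1 : v < 1) : 0 ≤ bkC n v ∧ bkC n v ≤ v := by
  have hpos : ∀ l : ℕ, 0 ≤ ((l : ℝ) + 1 + v) * (l + 1 - v) := by
    intro l
    have : (0 : ℝ) ≤ l := Nat.cast_nonneg l
    apply mul_nonneg <;> linarith
  have hle : ∏ l ∈ range n, (((l : ℝ) + 1 + v) * (l + 1 - v)) ≤ (n.factorial : ℝ) ^ 2 := by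
    rw [← prod_range_add_one_eq_factorial]
    push_cast
    rw [← prod_pow]
    apply prod_le_prod
    · intro l _; exact hpos l
    · intro l _; nlinarith
  have hP : 0 ≤ ∏ l ∈ range n, (((l : ℝ) + 1 + v) * (l + 1 - v)) := prod_nonneg fun l _ => hpos l
  unfold bkC
  constructor
  · positivity
  · rw [div_le_iff₀ (by positivity)]
    gcongr

lemma bk_int_bound (n : ℕ) (v y : ℝ) (hy : 1 ≤ y) (h1 : v < 1) :
    0 ≤ ∫ u in (1 : ℝ)..y, (u - 1) ^ n * (y - u) ^ n * u ^ (v - n - 1) ∧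
    ∫ u in (1 : ℝ)..y, (u - 1) ^ n * (y - u) ^ n * u ^ (v - n - 1) ≤
      (y - 1) * ((Real.sqrt y - 1) ^ 2) ^ n := by
  have hcont : ContinuousOn (fun u : ℝ => (u - 1) ^ n * (y - u) ^ n * u ^ (v - n - 1))
      (Set.uIcc 1 y) := by
    apply ContinuousOn.mul (by fun_prop)
    apply ContinuousOn.rpow_const continuousOn_id
    intro u hu
    rw [Set.uIcc_of_le hy] at hu
    left
    have := hu.1
    simp only [id]
    linarith
  constructor
  · apply intervalIntegral.integral_nonneg hy
    intro u hu
    have a : 0 ≤ u - 1 := by linarith [hu.1]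
    have b : 0 ≤ y - u := by linarith [hu.2]
    have c : 0 ≤ u := by linarith
    positivity
  · have : (y - 1) * ((Real.sqrt y - 1) ^ 2) ^ n =
        ∫ u in (1 : ℝ)..y, ((Real.sqrt y - 1) ^ 2) ^ n := by simp
    rw [this]
    apply intervalIntegral.integral_mono_on hy hcont.intervalIntegrable (by simp)
    intro u hu
    have a : 0 ≤ u - 1 := by linarith [hu.1]
    have b : 0 ≤ y - u := by linarith [hu.2]
    have c : 0 < u := by linarith
    have e : (u - 1) ^ n * (y - u) ^ n * u ^ (v - n - 1) =
        ((u - 1) * (y - u) / u) ^ n * u ^ (v - 1) := by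
      rw [show v - n - 1 = v - 1 - n by ring, Real.rpow_sub c, Real.rpow_natCast, div_pow, mul_pow]
      ring
    rw [e]
    have f : u ^ (v - 1) ≤ 1 := Real.rpow_le_one_of_one_le_of_nonpos hu.1 (by linarith)
    have g : (u - 1) * (y - u) / u ≤ (Real.sqrt y - 1) ^ 2 := by
      rw [div_le_iff₀ c]
      have hs := Real.sq_sqrt (show 0 ≤ y by linarith)
      nlinarith [sq_nonneg (u - Real.sqrt y)]
    calc _ ≤ ((Real.sqrt y - 1) ^ 2) ^ n * 1 := by gcongr
      _ = _ := mul_one _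

open Finset in
lemma bk_vander (n : ℕ) (v N : ℝ) :
    ∑ i ∈ range (n + 1), Ring.choose ((n : ℝ) + v) (n - i) * Ring.choose ((n : ℝ) - v) i *
      ((N + 1) ^ i * N ^ (n - i)) =
    ∑ j ∈ range (n + 1), Ring.choose ((n : ℝ) - v) j * ((2 * n - j).choose (n - j) : ℝ) *
      N ^ (n - j) := by
  have e1 : ∀ i ∈ range (n + 1), (N + 1) ^ i * N ^ (n - i) =
      ∑ j ∈ range (n + 1), (i.choose j : ℝ) * N ^ (n - j) := by
    intro i hi
    have hi' := mem_range_succ_iff.1 hi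
    have hsub : range (i + 1) ⊆ range (n + 1) := range_subset_range.2 (by omega)
    rw [← sum_subset hsub]
    · rw [add_comm N 1, add_pow, sum_mul]
      apply sum_congr rfl
      intro j hj
      have hj' := mem_range_succ_iff.1 hj
      rw [show n - j = (i - j) + (n - i) by omega, pow_add]
      simp
      ring
    · intro j _ hj
      have : i < j := by
        by_contra h
        exact hj (mem_range_succ_iff.2 (by omega))
      rw [Nat.choose_eq_zero_of_lt this]
      simp
  rw [sum_congr rfl (fun i hi => by rw [e1 i hi, mul_sum]), sum_comm]
  apply sum_congr rfl
  intro j hj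
  have hj' := mem_range_succ_iff.1 hj
  obtain ⟨m, rfl⟩ := Nat.exists_eq_add_of_le hj'
  have e2 : ((2 * (j + m) - j).choose (j + m - j) : ℝ) =
      ∑ l ∈ range (m + 1), Ring.choose (((j + m : ℕ) : ℝ) - v - j) l *
        Ring.choose (((j + m : ℕ) : ℝ) + v) (m - l) := by
    rw [← Nat.sum_antidiagonal_eq_sum_range_succ
      (fun a b => Ring.choose (((j + m : ℕ) : ℝ) - v - j) a * Ring.choose (((j + m : ℕ) : ℝ) + v) b),
      ← Ring.add_choose_eq m (Commute.all _ _), Nat.add_sub_cancel_left, ← Ring.choose_natCast (R := ℝ),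
      show 2 * (j + m) - j = j + m + m by omega]
    congr 1
    push_cast; ring
  rw [e2, mul_sum, sum_mul, show j + m + 1 = j + (m + 1) by ring, sum_range_add]
  rw [sum_eq_zero, zero_add]
  · apply sum_congr rfl
    intro l hl
    have h := Ring.choose_smul_choose (((j + m : ℕ) : ℝ) - v) (Nat.le_add_right j l)
    rw [Nat.add_sub_cancel_left, nsmul_eq_mul] at h
    rw [show j + m - (j + l) = m - l by omega]
    linear_combination (Ring.choose (((j + m : ℕ) : ℝ) + v) (m - l) * N ^ (j + m - j)) * h
  · intro i hi
    rw [Nat.choose_eq_zero_of_lt (mem_range.1 hi)]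
    simp

open Finset in
lemma bk_choose_pos (n m : ℕ) (hm : m ≤ n) (v : ℝ) (h1 : v < 1) :
    0 < Ring.choose ((n : ℝ) - v) m := by
  have h := bk_fact_mul_choose ((n : ℝ) - v) m
  have : 0 < ∏ l ∈ range m, ((n : ℝ) - v - l) := by
    apply prod_pos
    intro l hl
    have : l + 1 ≤ n := by have := mem_range.1 hl; omega
    have : (l : ℝ) + 1 ≤ n := by exact_mod_cast this
    linarith
  rw [← h] at this
  exact pos_of_mul_pos_right this (by positivity)

open Finset in
lemma bk_choose_le (n m : ℕ) (hm : m ≤ n) (v : ℝ) (h0 : 0 ≤ v) (h1 : v < 1) :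
    Ring.choose ((n : ℝ) - v) m ≤ Ring.choose ((n : ℝ) - 0) m := by
  have h := bk_fact_mul_choose ((n : ℝ) - v) m
  have h' := bk_fact_mul_choose ((n : ℝ) - 0) m
  have : ∏ l ∈ range m, ((n : ℝ) - v - l) ≤ ∏ l ∈ range m, ((n : ℝ) - 0 - l) := by
    apply prod_le_prod
    · intro l hl
      have : l + 1 ≤ n := by have := mem_range.1 hl; omega
      have : (l : ℝ) + 1 ≤ n := by exact_mod_cast this
      linarith
    · intro l hl
      linarith
  rw [← h, ← h'] at this
  exact le_of_mul_le_mul_left this (by positivity)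

open Finset in
lemma bk_Q_bound (n : ℕ) (v N : ℝ) (hN : 0 ≤ N) (h0 : 0 ≤ v) (h1 : v < 1) :
    ∑ i ∈ range (n + 1), Ring.choose ((n : ℝ) + v) (n - i) * Ring.choose ((n : ℝ) - v) i *
      ((N + 1) ^ i * N ^ (n - i)) ≤ ((Real.sqrt N + Real.sqrt (N + 1)) ^ 2) ^ n := by
  rw [bk_vander]
  calc _ ≤ ∑ j ∈ range (n + 1), Ring.choose ((n : ℝ) - 0) j * ((2 * n - j).choose (n - j) : ℝ) *
      N ^ (n - j) := by
        apply sum_le_sum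
        intro j hj
        have := bk_choose_le n j (mem_range_succ_iff.1 hj) v h0 h1
        gcongr
    _ = ∑ i ∈ range (n + 1), ((n.choose i : ℝ)) ^ 2 * ((N + 1) ^ i * N ^ (n - i)) := by
        rw [← bk_vander]
        apply sum_congr rfl
        intro i hi
        rw [add_zero, sub_zero, Ring.choose_natCast, Ring.choose_natCast,
          Nat.choose_symm (mem_range_succ_iff.1 hi)]
        ring
    _ = ∑ i ∈ range (n + 1), (Real.sqrt (N + 1) ^ i * Real.sqrt N ^ (n - i) * (n.choose i : ℝ)) ^ 2 := by
        apply sum_congr rfl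
        intro i _
        rw [mul_pow, mul_pow, ← pow_mul, ← pow_mul, mul_comm i 2, mul_comm (n - i) 2, pow_mul, pow_mul,
          Real.sq_sqrt hN, Real.sq_sqrt (by linarith)]
        ring
    _ ≤ (∑ i ∈ range (n + 1), (Real.sqrt (N + 1) ^ i * Real.sqrt N ^ (n - i) * (n.choose i : ℝ))) ^ 2 := by
        apply sum_sq_le_sq_sum_of_nonneg
        intro i _
        positivity
    _ = _ := by
        rw [← add_pow, ← pow_mul, ← pow_mul, mul_comm 2 n, add_comm]

open Finset in
lemma bk_fact_dvd_prod (x : ℤ) (m : ℕ) :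
    (m.factorial : ℤ) ∣ ∏ l ∈ range m, (x - l) := by
  have h := Ring.descPochhammer_eq_factorial_smul_choose x m
  rw [nsmul_eq_mul] at h
  have h2 : (descPochhammer ℤ m).smeval x = ∏ l ∈ range m, (x - l) := by
    clear h
    induction m with
    | zero => simp
    | succ m ih =>
      rw [prod_range_succ, ← ih, descPochhammer_succ_right, Polynomial.smeval_mul]
      simp [Polynomial.smeval_sub, Polynomial.smeval_natCast]
  rw [← h2, h]
  exact dvd_mul_right _ _

open Finset in
lemma bk_int_choose (k p m : ℕ) (hp : p.Prime) (hk : 0 < k)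
    (hcop : ∀ M : ℕ, ¬ p ∣ M → Nat.Coprime k M) (c : ℤ) :
    ∃ z : ℤ, (k : ℝ) ^ m * (p : ℝ) ^ (m.factorial.factorization p) *
      Ring.choose ((c : ℝ) / k) m = z := by
  set e := m.factorial.factorization p with he
  set M := m.factorial / p ^ e with hM
  have hfac : p ^ e * M = m.factorial := Nat.ordProj_mul_ordCompl_eq_self m.factorial p
  have hpM : ¬ p ∣ M := Nat.not_dvd_ordCompl hp (Nat.factorial_ne_zero m)
  have hc := Nat.isCoprime_iff_coprime.2 (hcop M hpM)
  obtain ⟨a, b, hab⟩ := hc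
  have hdiv : (M : ℤ) ∣ ∏ l ∈ range m, (c - k * l) := by
    have h1 : (M : ℤ) ∣ ∏ l ∈ range m, ((k : ℤ) * (a * c - l)) := by
      rw [prod_mul_distrib]
      apply Dvd.dvd.mul_left
      refine dvd_trans ?_ (bk_fact_dvd_prod (a * c) m)
      rw [← hfac]
      push_cast
      exact dvd_mul_left _ _
    have h2 : ∏ l ∈ range m, ((k : ℤ) * (a * c - l)) ≡ ∏ l ∈ range m, (c - k * l) [ZMOD M] := by
      apply Int.ModEq.prod
      intro l _
      apply (Int.modEq_iff_dvd).2
      refine ⟨b * c, ?_⟩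
      linear_combination (-c) * hab
    exact (Int.ModEq.dvd_iff h2).1 h1
  obtain ⟨w, hw⟩ := hdiv
  refine ⟨w, ?_⟩
  have hL := bk_fact_mul_choose ((c : ℝ) / k) m
  have hk' : (k : ℝ) ≠ 0 := by positivity
  have hw' : (k : ℝ) ^ m * ∏ l ∈ range m, ((c : ℝ) / k - l) = M * w := by
    have : ((∏ l ∈ range m, (c - k * l) : ℤ) : ℝ) = ((M * w : ℤ) : ℝ) := by rw [hw]
    push_cast at this
    have hkm : (k : ℝ) ^ m = ∏ _l ∈ range m, (k : ℝ) := by simp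
    rw [← this, hkm, ← prod_mul_distrib]
    apply prod_congr rfl
    intro l _
    field_simp
  rw [← hL, ← hfac] at hw'
  push_cast at hw'
  have hM0 : (M : ℝ) ≠ 0 := by
    intro h
    have : M = 0 := by exact_mod_cast h
    rw [this] at hpM
    exact hpM (dvd_zero _)
  apply mul_left_cancel₀ hM0
  linear_combination hw'

lemma bk_int_choose2 (k p n i : ℕ) (hi : i ≤ n) (hp : p.Prime) (hk : 0 < k)
    (hcop : ∀ M : ℕ, ¬ p ∣ M → Nat.Coprime k M) (c d : ℤ) :
    ∃ z : ℤ, (k : ℝ) ^ n * (p : ℝ) ^ (n.factorial.factorization p) *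
      (Ring.choose ((c : ℝ) / k) (n - i) * Ring.choose ((d : ℝ) / k) i) = z := by
  obtain ⟨z1, h1⟩ := bk_int_choose k p (n - i) hp hk hcop c
  obtain ⟨z2, h2⟩ := bk_int_choose k p i hp hk hcop d
  have hle : (n - i).factorial.factorization p + i.factorial.factorization p ≤
      n.factorial.factorization p := by
    have hd : (n - i).factorial * i.factorial ∣ n.factorial := by
      have := Nat.factorial_mul_factorial_dvd_factorial hi
      rwa [mul_comm] at this
    have := (Nat.factorization_le_iff_dvd (by positivity) (by positivity)).2 hd p
    rw [Nat.factorization_mul (by positivity) (by positivity)] at this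
    simpa using this
  obtain ⟨w, hw⟩ := Nat.exists_eq_add_of_le hle
  refine ⟨z1 * z2 * (p : ℤ) ^ w, ?_⟩
  push_cast
  rw [← h1, ← h2, hw, pow_add, pow_add]
  have : (k : ℝ) ^ n = k ^ (n - i) * k ^ i := by rw [← pow_add]; congr 1; omega
  rw [this]
  ring

lemma bk_int_sum (k p n N : ℕ) (hp : p.Prime) (hk : 0 < k)
    (hcop : ∀ M : ℕ, ¬ p ∣ M → Nat.Coprime k M) (c d : ℤ) :
    ∃ z : ℤ, (k : ℝ) ^ n * (p : ℝ) ^ (n.factorial.factorization p) *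
      ∑ i ∈ Finset.range (n + 1), Ring.choose ((c : ℝ) / k) (n - i) * Ring.choose ((d : ℝ) / k) i *
        (((N : ℝ) + 1) ^ i * (N : ℝ) ^ (n - i)) = z := by
  have h : ∀ i : ℕ, ∃ z : ℤ, i ≤ n → (k : ℝ) ^ n * (p : ℝ) ^ (n.factorial.factorization p) *
      (Ring.choose ((c : ℝ) / k) (n - i) * Ring.choose ((d : ℝ) / k) i) = z := by
    intro i
    by_cases hi : i ≤ n
    · obtain ⟨z, hz⟩ := bk_int_choose2 k p n i hi hp hk hcop c d
      exact ⟨z, fun _ => hz⟩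
    · exact ⟨0, fun h => absurd h hi⟩
  choose f hf using h
  refine ⟨∑ i ∈ Finset.range (n + 1), f i * (((N : ℤ) + 1) ^ i * (N : ℤ) ^ (n - i)), ?_⟩
  push_cast
  rw [Finset.mul_sum]
  apply Finset.sum_congr rfl
  intro i hi
  rw [← hf i (Finset.mem_range_succ_iff.1 hi)]
  ring

lemma bk_approx (k p N n : ℕ) (hp : p.Prime) (hk : 2 ≤ k) (hN : 1 ≤ N)
    (hcop : ∀ M : ℕ, ¬ p ∣ M → Nat.Coprime k M) (rho D : ℝ)
    (hrho : rho = (Real.sqrt N + Real.sqrt ((N : ℝ) + 1)) ^ 2)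
    (hD : D = (k : ℝ) ^ n * (p : ℝ) ^ (n.factorial.factorization p)) :
    ∃ A B : ℤ, 0 < B ∧ (B : ℝ) ≤ D * rho ^ n ∧
      0 ≤ (B : ℝ) * (((N : ℝ) + 1) / N) ^ ((1 : ℝ) / k) - A ∧
      (B : ℝ) * (((N : ℝ) + 1) / N) ^ ((1 : ℝ) / k) - A ≤ D * (1 / (k * N)) / rho ^ n := by
  have hk0 : (0 : ℝ) < k := by positivity
  have hN0 : (0 : ℝ) < N := by positivity
  have hp0 : (0 : ℝ) < p := by exact_mod_cast hp.pos
  have hD0 : 0 < D := by rw [hD]; positivity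
  set v : ℝ := 1 / k with hv
  have hv0 : 0 < v := by positivity
  have hv1 : v < 1 := by
    rw [hv, div_lt_one hk0]
    exact_mod_cast hk
  obtain ⟨B, hB⟩ := bk_int_sum k p n N hp (by omega) hcop (k * n + 1) (k * n - 1)
  obtain ⟨A, hA⟩ := bk_int_sum k p n N hp (by omega) hcop (k * n - 1) (k * n + 1)
  have c1 : (((k * n + 1 : ℤ) : ℝ)) / k = (n : ℝ) + v := by
    push_cast; rw [hv]; field_simp
  have c2 : (((k * n - 1 : ℤ) : ℝ)) / k = (n : ℝ) - v := by
    push_cast; rw [hv]; field_simp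
  rw [c1, c2, ← hD] at hA hB
  set y : ℝ := ((N : ℝ) + 1) / N with hy
  have hy1 : 1 ≤ y := by rw [hy, le_div_iff₀ hN0]; linarith
  have conv : ∀ f : ℕ → ℝ, ∑ i ∈ Finset.range (n + 1), f i * (((N : ℝ) + 1) ^ i * (N : ℝ) ^ (n - i)) =
      (N : ℝ) ^ n * ∑ i ∈ Finset.range (n + 1), f i * y ^ i := by
    intro f
    rw [Finset.mul_sum]
    apply Finset.sum_congr rfl
    intro i hi
    have : (N : ℝ) ^ n = N ^ i * N ^ (n - i) := by
      rw [← pow_add]; congr 1; have := Finset.mem_range_succ_iff.1 hi; omega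
    rw [this, hy, div_pow]
    field_simp
  have hpade := bk_pade n v y hy1 (bk_not_int hv0 hv1)
  obtain ⟨C0, C1⟩ := bkC_bound n v hv0 hv1
  obtain ⟨I0, I1⟩ := bk_int_bound n v y hy1 hv1
  have hrem : (B : ℝ) * y ^ v - A = D * (N : ℝ) ^ n *
      (bkC n v * ∫ u in (1 : ℝ)..y, (u - 1) ^ n * (y - u) ^ n * u ^ (v - n - 1)) := by
    rw [← hA, ← hB, conv, conv, hpade]
    ring
  refine ⟨A, B, ?_, ?_, ?_, ?_⟩
  · have : (0 : ℝ) < B := by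
      rw [← hB]
      apply mul_pos hD0
      apply Finset.sum_pos
      · intro i hi
        have hi' := Finset.mem_range_succ_iff.1 hi
        have := bk_choose_pos n i hi' v hv1
        have h2 := bk_choose_pos n (n - i) (by omega) (-v) (by linarith)
        rw [sub_neg_eq_add] at h2
        positivity
      · simp
    exact_mod_cast this
  · rw [← hB, hrho]
    gcongr
    exact bk_Q_bound n v N hN0.le hv0.le hv1
  · rw [hrem]
    positivity
  · rw [hrem]
    have hroot : (N : ℝ) * (Real.sqrt y - 1) ^ 2 = 1 / rho := by
      have hs : Real.sqrt y = Real.sqrt ((N : ℝ) + 1) / Real.sqrt N := by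
        rw [hy, Real.sqrt_div (by positivity)]
      have s1 := Real.sq_sqrt hN0.le
      have s2 := Real.sq_sqrt (show (0 : ℝ) ≤ (N : ℝ) + 1 by positivity)
      have s3 : 0 < Real.sqrt N := Real.sqrt_pos.2 hN0
      have s4 : 0 ≤ Real.sqrt ((N : ℝ) + 1) := Real.sqrt_nonneg _
      rw [hrho, hs]
      generalize Real.sqrt ((N : ℝ) + 1) = w at *
      generalize Real.sqrt (N : ℝ) = x at *
      have h5 : (N : ℝ) * (w / x - 1) ^ 2 = (w - x) ^ 2 := by
        rw [← s1]; field_simp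
      rw [h5, eq_div_iff (by positivity)]
      have : (w - x) * (x + w) = 1 := by nlinarith
      rw [← mul_pow, this, one_pow]
    have hyv : y - 1 = 1 / N := by rw [hy]; field_simp; ring
    calc _ ≤ D * (N : ℝ) ^ n * (v * ((y - 1) * ((Real.sqrt y - 1) ^ 2) ^ n)) := by gcongr
      _ = D * (v * (y - 1)) * ((N : ℝ) * (Real.sqrt y - 1) ^ 2) ^ n := by rw [mul_pow]; ring
      _ = _ := by
        rw [hroot, hyv, hv, div_pow, one_pow]
        field_simp

lemma bk_D_bound (p n : ℕ) (hp : p.Prime) :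
    (p : ℝ) ^ (n.factorial.factorization p) ≤ ((p : ℝ) ^ ((1 : ℝ) / ((p : ℝ) - 1))) ^ n := by
  have := Fact.mk hp
  have h := sub_one_mul_padicValNat_factorial (p := p) n
  have h2 : (p - 1) * n.factorial.factorization p ≤ n := by
    rw [Nat.factorization_def _ hp, h]; omega
  have hp1 : (1 : ℝ) < p := by exact_mod_cast hp.one_lt
  have h3 : ((p : ℝ) - 1) * (n.factorial.factorization p : ℝ) ≤ n := by
    have : (((p - 1) * n.factorial.factorization p : ℕ) : ℝ) ≤ n := by exact_mod_cast h2
    rw [Nat.cast_mul, Nat.cast_sub hp.one_lt.le] at this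
    simpa using this
  rw [← Real.rpow_natCast, ← Real.rpow_natCast, ← Real.rpow_mul (by linarith)]
  apply Real.rpow_le_rpow_of_exponent_le hp1.le
  rw [one_div, inv_mul_eq_div, le_div_iff₀ (by linarith)]
  linarith

lemma bk_core (q δ g E L Qc : ℝ) (hE : 1 < E) (hL : 0 ≤ L) (hQ : Qc = E ^ L)
    (hq : 0 < q) (hg : 0 < g) (hδ : 0 < δ)
    (hall : ∀ n : ℕ, 1 ≤ Qc ^ n * δ + q * g / E ^ n) :
    1 / 2 ≤ δ ∨ 1 / 2 ≤ Qc * (2 * q * g) ^ L * δ := by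
  classical
  have hE0 : 0 < E := by linarith
  have hex : ∃ n : ℕ, 2 * q * g ≤ E ^ n := by
    obtain ⟨n, hn⟩ := pow_unbounded_of_one_lt (2 * q * g) hE
    exact ⟨n, hn.le⟩
  have hspec := Nat.find_spec hex
  have hmin := fun m => Nat.find_min (H := hex) (m := m)
  set n := Nat.find hex with hn
  clear_value n
  have hEn : 0 < E ^ n := by positivity
  have h1 : q * g / E ^ n ≤ 1 / 2 := by
    rw [div_le_iff₀ hEn]; linarith
  have h2 := hall n
  have h3 : 1 / 2 ≤ Qc ^ n * δ := by linarith
  rcases n with _ | m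
  · left; simpa using h3
  · right
    have h4 := hmin m (Nat.lt_succ_self m)
    push Not at h4
    have hQ0 : 0 < Qc := by rw [hQ]; positivity
    have h5 : Qc ^ m ≤ (2 * q * g) ^ L := by
      rw [hQ, ← Real.rpow_natCast, ← Real.rpow_mul hE0.le, mul_comm, Real.rpow_mul hE0.le,
        Real.rpow_natCast]
      gcongr
    refine h3.trans ?_
    rw [pow_succ, mul_comm (Qc ^ m)]
    gcongr

lemma bk_final (k : ℕ) (hk : 3 ≤ k) (N X q μ rho L δ : ℝ) (hN : 4 ≤ N) (hX : N ≤ X)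
    (hμ : 0 < μ) (hrho0 : 0 < rho) (hrho : rho ≤ 8 * N) (hL : 1 ≤ L) (hq : 0 < q)
    (hqk : q ^ k ≤ 2 * N * X) (hδ : 0 < δ) (hδX : δ < q / (k * X))
    (hcase : 1 / 2 ≤ δ ∨ 1 / 2 ≤ (k * μ * rho) * (2 * q * (1 / (k * N))) ^ L * δ) :
    X ^ ((k : ℝ) - (1 + L)) < 8 ^ k * μ ^ k * N ^ ((k : ℝ) + (1 + L)) := by
  have hN0 : 0 < N := by linarith
  have hX0 : 0 < X := by linarith
  have hk3 : (3 : ℝ) ≤ k := by exact_mod_cast hk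
  have hk0 : (0 : ℝ) < k := by linarith
  rw [lt_div_iff₀ (by positivity)] at hδX
  rcases hcase with h | h
  · exfalso
    have h1 : X < q := by nlinarith [mul_le_mul h hk3 (by norm_num) hδ.le]
    have h2 : X ^ 3 ≤ X ^ k := pow_le_pow_right₀ (by linarith) hk
    have h3 : X ^ k < q ^ k := by
      apply pow_lt_pow_left₀ h1 hX0.le; omega
    have h4 : X ^ 3 < 2 * N * X := by linarith
    nlinarith [mul_pos hX0 hX0]
  · have hz : 2 * q * (1 / (k * N)) ≤ q / N := by
      rw [mul_one_div, div_le_div_iff₀ (by positivity) hN0]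
      nlinarith [mul_pos hq hN0]
    have h1 : (k : ℝ) * X < (2 * (k * μ * rho) * (q / N) ^ L) * q := by
      have hz' : (2 * q * (1 / (k * N))) ^ L ≤ (q / N) ^ L := by gcongr
      have : 1 / 2 ≤ (k * μ * rho) * (q / N) ^ L * δ := h.trans (by gcongr)
      set W := (k * μ * rho) * (q / N) ^ L with hW
      have hW0 : 0 < W := by positivity
      nlinarith [mul_lt_mul_of_pos_left hδX hW0, mul_pos hk0 hX0]
    have h2 : X < 16 * μ * N * (q / N) ^ L * q := by
      have : X < 2 * μ * rho * (q / N) ^ L * q := by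
        apply lt_of_mul_lt_mul_left _ hk0.le
        linarith
      refine this.trans_le ?_
      have : 2 * μ * rho ≤ 16 * μ * N := by nlinarith
      gcongr
    have h3 : X ^ k < (16 * μ * N * (q / N) ^ L * q) ^ k := by
      apply pow_lt_pow_left₀ h2 hX0.le; omega
    have h4 : (16 * μ * N * (q / N) ^ L * q) ^ k =
        16 ^ k * μ ^ k * N ^ k * (q ^ k) ^ (1 + L) / N ^ ((k : ℝ) * L) := by
      rw [Real.div_rpow hq.le hN0.le, Real.rpow_add (by positivity), Real.rpow_one]
      rw [← Real.rpow_natCast q k, ← Real.rpow_mul hq.le, Real.rpow_natCast, mul_comm (k : ℝ) L,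
        Real.rpow_mul hq.le, Real.rpow_mul hN0.le, Real.rpow_natCast, Real.rpow_natCast]
      simp only [mul_pow, div_pow]
      ring
    have h5 : (q ^ k) ^ (1 + L) ≤ (2 : ℝ) ^ (1 + L) * N ^ (1 + L) * X ^ (1 + L) := by
      rw [← Real.mul_rpow (by norm_num) hN0.le, ← Real.mul_rpow (by positivity) hX0.le]
      gcongr
    have h6 : (2 : ℝ) ^ k * 2 ^ (1 + L) ≤ N ^ ((k : ℝ) * L) := by
      calc (2 : ℝ) ^ k * 2 ^ (1 + L) = 2 ^ ((k : ℝ) + (1 + L)) := by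
            rw [Real.rpow_add (by norm_num) (k : ℝ), Real.rpow_natCast]
        _ ≤ 2 ^ (2 * ((k : ℝ) * L)) := by
            apply Real.rpow_le_rpow_of_exponent_le (by norm_num)
            nlinarith
        _ = 4 ^ ((k : ℝ) * L) := by
            rw [Real.rpow_mul (by norm_num)]; norm_num
        _ ≤ _ := by gcongr
    rw [Real.rpow_sub hX0, Real.rpow_natCast, div_lt_iff₀ (by positivity)]
    refine h3.trans_le ?_
    rw [h4, div_le_iff₀ (by positivity), Real.rpow_add hN0 (k : ℝ), Real.rpow_natCast]
    calc _ ≤ 16 ^ k * μ ^ k * N ^ k * ((2 : ℝ) ^ (1 + L) * N ^ (1 + L) * X ^ (1 + L)) := by gcongr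
      _ = (8 ^ k * μ ^ k * (N ^ k * N ^ (1 + L)) * X ^ (1 + L)) * (2 ^ k * 2 ^ (1 + L)) := by
          rw [show (16 : ℝ) = 8 * 2 by norm_num, mul_pow]; ring
      _ ≤ _ := by gcongr

lemma bk_delta (k : ℕ) (hk : 3 ≤ k) (A b c w θ : ℝ) (hA : 1 < A) (hAb : A < b) (hbc : b < c)
    (hw : 0 < w) (hθ : 1 ≤ θ)
    (hθk : θ ^ k = (A * b + 1) / (A * b))
    (hwk : w ^ k = (A * c + 1) * (A * b + 1) / (A ^ 2 * (b * c + 1))) :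
    θ < w ∧ w - θ < 1 / (k * (A * c)) := by
  have hA0 : 0 < A := by linarith
  have hb0 : 0 < b := by linarith
  have hc0 : 0 < c := by linarith
  have hk0 : (0 : ℝ) < k := by positivity
  have hθ0 : 0 < θ := by linarith
  have hratio : w ^ k = θ ^ k * (1 + (b - A) / (A * (b * c + 1))) := by
    rw [hwk, hθk]; field_simp; ring
  have hpos : 0 < (b - A) / (A * (b * c + 1)) := by
    have : 0 < b - A := by linarith
    positivity
  have h1 : θ < w := by
    apply lt_of_pow_lt_pow_left₀ k hw.le
    rw [hratio]
    have : 0 < θ ^ k := by positivity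
    nlinarith
  refine ⟨h1, ?_⟩
  set ε := (w - θ) / θ with hε
  have hε0 : 0 < ε := by
    have : 0 < w - θ := by linarith
    positivity
  have hwε : w = θ * (1 + ε) := by rw [hε]; field_simp; ring
  have hb1 : 1 + (k : ℝ) * ε ≤ (1 + ε) ^ k := one_add_mul_le_pow (by linarith) k
  have hb2 : (1 + ε) ^ k = 1 + (b - A) / (A * (b * c + 1)) := by
    have : 0 < θ ^ k := by positivity
    apply mul_left_cancel₀ this.ne'
    rw [← hratio, hwε, mul_pow]
  have hb3 : (k : ℝ) * ε ≤ (b - A) / (A * (b * c + 1)) := by linarith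
  have hθ2 : θ ≤ (A * b + 1) / (A * b) := by
    rw [← hθk]
    exact le_self_pow₀ hθ (by omega)
  have hfin : (A * b + 1) / (A * b) * ((b - A) / (A * (b * c + 1))) < 1 / (A * c) := by
    rw [div_mul_div_comm, div_lt_div_iff₀ (by positivity) (by positivity)]
    have : c * (b - A - A ^ 2 * b) < A * b := by
      have h1 : b - A - A ^ 2 * b < 0 := by nlinarith [mul_pos hA0 hb0]
      nlinarith [mul_pos hA0 hb0]
    nlinarith
  have : (k : ℝ) * (w - θ) < 1 / (A * c) := by
    calc (k : ℝ) * (w - θ) = θ * (k * ε) := by rw [hwε]; ring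
      _ ≤ (A * b + 1) / (A * b) * ((b - A) / (A * (b * c + 1))) := by gcongr
      _ < _ := hfin
  rw [lt_div_iff₀ (by positivity)] at this ⊢
  linarith

set_option maxHeartbeats 2000000 in
lemma bk_main (k p : ℕ) (a b c r s t : ℤ) (hk : 3 ≤ k) (hp : p.Prime) (hpk : p ≤ k)
    (hcop : ∀ M : ℕ, ¬ p ∣ M → Nat.Coprime k M)
    (ha : 1 < a) (hbc : b < c) (hakb : a ^ k < b)
    (hr : 0 < r) (hs : 0 < s) (ht : 0 < t)
    (h1 : a ^ k * b + 1 = r ^ k) (h2 : a ^ k * c + 1 = s ^ k)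
    (h3 : b * c + 1 = t ^ k)
    (N μ lam : ℝ) (hN : N = (a : ℝ) ^ k * b)
    (hμ : μ = (p : ℝ) ^ ((1 : ℝ) / ((p : ℝ) - 1)))
    (hlam : lam = 1 + Real.log ((k : ℝ) * μ * (Real.sqrt N + Real.sqrt (N + 1)) ^ 2) /
      Real.log ((1 / ((k : ℝ) * μ)) * (Real.sqrt N + Real.sqrt (N + 1)) ^ 2)) :
    ((a : ℝ) ^ k * c) ^ ((k : ℝ) - lam) < 8 ^ k * μ ^ k * ((a : ℝ) ^ k * b) ^ ((k : ℝ) + lam) := by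
  have haR : (2 : ℝ) ≤ a := by exact_mod_cast ha
  have hAb : (a : ℝ) ^ k < b := by exact_mod_cast hakb
  have hbcR : (b : ℝ) < c := by exact_mod_cast hbc
  have hsR : (0 : ℝ) < s := by exact_mod_cast hs
  have hrR : (0 : ℝ) < r := by exact_mod_cast hr
  have htR : (0 : ℝ) < t := by exact_mod_cast ht
  have e1 : (a : ℝ) ^ k * b + 1 = (r : ℝ) ^ k := by exact_mod_cast h1
  have e2 : (a : ℝ) ^ k * c + 1 = (s : ℝ) ^ k := by exact_mod_cast h2
  have e3 : (b : ℝ) * c + 1 = (t : ℝ) ^ k := by exact_mod_cast h3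
  have hA2 : (2 : ℝ) ^ k ≤ (a : ℝ) ^ k := by gcongr
  have hk2 : (k : ℝ) < 2 ^ k := by exact_mod_cast Nat.lt_two_pow_self
  have hkR : (3 : ℝ) ≤ k := by exact_mod_cast hk
  obtain ⟨n0, hn0⟩ : ∃ n0 : ℕ, a ^ k * b = n0 := by
    apply Int.eq_ofNat_of_zero_le
    have : 0 < a ^ k := by positivity
    have : 0 < b := by omega
    positivity
  have hNn : N = (n0 : ℝ) := by rw [hN]; exact_mod_cast hn0
  set A : ℝ := (a : ℝ) ^ k with hA
  have hkN : (k : ℝ) * k < N := by rw [hN]; nlinarith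
  have hN4 : 4 ≤ N := by nlinarith
  have hp1 : (1 : ℝ) < p := by exact_mod_cast hp.one_lt
  have hμ1 : 1 ≤ μ := by
    rw [hμ]
    apply Real.one_le_rpow hp1.le
    apply div_nonneg zero_le_one; linarith
  have hμk : μ ≤ k := by
    have hp2 : (2 : ℝ) ≤ p := by exact_mod_cast hp.two_le
    have : μ ≤ (p : ℝ) ^ (1 : ℝ) := by
      rw [hμ]
      apply Real.rpow_le_rpow_of_exponent_le hp1.le
      rw [div_le_one (by linarith)]; linarith
    rw [Real.rpow_one] at this
    exact this.trans (by exact_mod_cast hpk)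
  set rho : ℝ := (Real.sqrt N + Real.sqrt (N + 1)) ^ 2 with hrho
  have hN0 : 0 ≤ N := by linarith
  have q1 := Real.sq_sqrt hN0
  have q2 := Real.sq_sqrt (show 0 ≤ N + 1 by linarith)
  have q3 := Real.sqrt_nonneg N
  have q4 := Real.sqrt_nonneg (N + 1)
  have hrhoN : N < rho := by rw [hrho]; nlinarith [mul_nonneg q3 q4]
  have hrho8 : rho ≤ 8 * N := by
    rw [hrho]; nlinarith [sq_nonneg (Real.sqrt N - Real.sqrt (N + 1))]
  have hrho0 : 0 < rho := by linarith
  have hμ0 : 0 < μ := by linarith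
  have hk0 : (0 : ℝ) < k := by linarith
  set E : ℝ := (1 / ((k : ℝ) * μ)) * rho with hE
  have hE1 : 1 < E := by
    rw [hE, one_div, inv_mul_eq_div, lt_div_iff₀ (by positivity)]
    nlinarith
  set L : ℝ := Real.log ((k : ℝ) * μ * rho) / Real.log E with hL
  have hEQ : E ≤ (k : ℝ) * μ * rho := by
    have hkm : 1 ≤ (k : ℝ) * μ := by nlinarith
    rw [hE]
    gcongr
    rw [div_le_iff₀ (by positivity)]
    nlinarith
  have hlogE : 0 < Real.log E := Real.log_pos hE1
  have hL1 : 1 ≤ L := by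
    rw [hL, le_div_iff₀ hlogE, one_mul]
    exact Real.log_le_log (by linarith) hEQ
  have hQ : (k : ℝ) * μ * rho = E ^ L := by
    rw [Real.rpow_def_of_pos (by linarith), hL, mul_div_cancel₀ _ hlogE.ne', Real.exp_log]
    positivity
  have hb0 : (0 : ℝ) < b := by linarith [pow_pos (show (0 : ℝ) < 2 by norm_num) k]
  have hA1 : 1 < A := by linarith
  have hA0 : 0 < A := by linarith
  have hc0 : (0 : ℝ) < c := by linarith
  set θ : ℝ := (((n0 : ℝ) + 1) / n0) ^ ((1 : ℝ) / k) with hθ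
  have hn0R : (0 : ℝ) < n0 := by rw [← hNn]; linarith
  have hθ1 : 1 ≤ θ := by
    rw [hθ]
    apply Real.one_le_rpow
    · rw [le_div_iff₀ hn0R]; linarith
    · positivity
  have hθk : θ ^ k = (A * b + 1) / (A * b) := by
    rw [hθ, one_div, Real.rpow_inv_natCast_pow (by positivity) (by omega), ← hNn, hN]
  set q : ℝ := (a : ℝ) ^ 2 * t with hq
  have hq0 : 0 < q := by positivity
  set w : ℝ := (s : ℝ) * r / q with hw
  have hw0 : 0 < w := by positivity
  have hqk' : q ^ k = A ^ 2 * (b * c + 1) := by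
    rw [hq, mul_pow, e3, hA]; ring
  have hwk : w ^ k = (A * c + 1) * (A * b + 1) / (A ^ 2 * (b * c + 1)) := by
    rw [hw, div_pow, hqk', mul_pow, e1, e2]
  obtain ⟨d1, d2⟩ := bk_delta k hk A b c w θ hA1 hAb hbcR hw0 hθ1 hθk hwk
  set δ : ℝ := (s : ℝ) * r - q * θ with hδ
  have hδw : δ = q * (w - θ) := by rw [hδ, hw]; field_simp
  have hδ0 : 0 < δ := by
    rw [hδw]; apply mul_pos hq0; linarith
  have hδX : δ < q / (k * (A * c)) := by
    rw [hδw, div_eq_mul_one_div]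
    gcongr
  have hall : ∀ n : ℕ, 1 ≤ ((k : ℝ) * μ * rho) ^ n * δ + q * (1 / (k * N)) / E ^ n := by
    intro n
    obtain ⟨P, B, hB0, hB1, hB2, hB3⟩ := bk_approx k p n0 n hp (by omega)
      (by exact_mod_cast (show (1 : ℝ) ≤ n0 by linarith)) hcop rho
      ((k : ℝ) ^ n * (p : ℝ) ^ (n.factorial.factorization p)) (by rw [hrho, hNn]) rfl
    rw [← hθ] at hB2 hB3
    have hDb : (k : ℝ) ^ n * (p : ℝ) ^ (n.factorial.factorization p) ≤ ((k : ℝ) * μ) ^ n := by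
      rw [mul_pow, hμ]
      gcongr
      exact bk_D_bound p n hp
    set D := (k : ℝ) ^ n * (p : ℝ) ^ (n.factorial.factorization p) with hD
    have hB0R : (0 : ℝ) < B := by exact_mod_cast hB0
    have hid : ((B * (s * r) - P * (a ^ 2 * t) : ℤ) : ℝ) = B * δ + q * (B * θ - P) := by
      push_cast
      rw [hδ, hq]; ring
    have hpos : (0 : ℝ) < ((B * (s * r) - P * (a ^ 2 * t) : ℤ) : ℝ) := by
      rw [hid]
      have := mul_pos hB0R hδ0
      have := mul_nonneg hq0.le hB2
      linarith
    have hge : (1 : ℝ) ≤ ((B * (s * r) - P * (a ^ 2 * t) : ℤ) : ℝ) := by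
      have : 0 < (B * (s * r) - P * (a ^ 2 * t) : ℤ) := by exact_mod_cast hpos
      exact_mod_cast this
    rw [hid] at hge
    refine hge.trans ?_
    have g1 : (B : ℝ) ≤ ((k : ℝ) * μ * rho) ^ n := by
      refine hB1.trans ?_
      rw [mul_pow _ rho]
      gcongr
    have g2 : (B : ℝ) * θ - P ≤ 1 / (k * N) / E ^ n := by
      refine hB3.trans ?_
      rw [hE, mul_pow, ← hNn, div_pow, one_pow]
      have hN0' : 0 < N := by linarith
      calc D * (1 / (k * N)) / rho ^ n ≤ ((k : ℝ) * μ) ^ n * (1 / (k * N)) / rho ^ n := by gcongr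
        _ = _ := by field_simp
    rw [mul_div_assoc]
    gcongr
  have hcase := bk_core q δ (1 / (k * N)) E L _ hE1 (by linarith) hQ hq0 (by
    have : 0 < N := by linarith
    positivity) hδ0 hall
  have hfin := bk_final k hk N (A * c) q μ rho L δ hN4 (by rw [hN]; gcongr) hμ0 hrho0 hrho8 hL1 hq0
    (by
      rw [hqk', hN]
      have : A ^ 2 * 1 ≤ A ^ 2 * (b * c) := by
        gcongr
        nlinarith
      nlinarith) hδ0 hδX hcase
  rw [hlam]
  rw [← hN]
  exact hfin



/-- For `k = 4` or `k` prime, and a `k`-th power Diophantine triple `{a^k, b, c}`,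
with `N := a^k b`, `μ_k` and `λ` as in Bennett's theorem, one has
`(a^k c)^{k-λ} < 8^k μ_k^k (a^k b)^{k+λ}`. -/
theorem akc_rpow_upper_bound
    (k : ℕ) (a b c r s t : ℤ) (hk : 3 ≤ k) (hk4 : k = 4 ∨ Nat.Prime k)
    (ha : 1 < a) (hab : a < b) (hbc : b < c) (hakb : a ^ k < b)
    (hr : 0 < r) (hs : 0 < s) (ht : 0 < t)
    (h1 : a ^ k * b + 1 = r ^ k) (h2 : a ^ k * c + 1 = s ^ k)
    (h3 : b * c + 1 = t ^ k)
    (N μ lam : ℝ) (hN : N = (a : ℝ) ^ k * b)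
    (hμ : μ = ∏ l ∈ k.primeFactors, (l : ℝ) ^ ((1 : ℝ) / ((l : ℝ) - 1)))
    (hlam : lam = 1 + Real.log ((k : ℝ) * μ * (Real.sqrt N + Real.sqrt (N + 1)) ^ 2) /
      Real.log ((1 / ((k : ℝ) * μ)) * (Real.sqrt N + Real.sqrt (N + 1)) ^ 2)) :
    ((a : ℝ) ^ k * c) ^ ((k : ℝ) - lam) < 8 ^ k * μ ^ k * ((a : ℝ) ^ k * b) ^ ((k : ℝ) + lam) := by
  rcases hk4 with rfl | hp
  · have hpf : Nat.primeFactors 4 = {2} := by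
      rw [show 4 = 2 ^ 2 by norm_num, Nat.primeFactors_prime_pow (by norm_num) Nat.prime_two]
    rw [hpf, Finset.prod_singleton] at hμ
    refine bk_main 4 2 a b c r s t hk Nat.prime_two (by norm_num) ?_ ha hbc hakb hr hs ht h1 h2 h3
      N μ lam hN hμ hlam
    intro M hM
    exact Nat.Coprime.pow_left 2 ((Nat.Prime.coprime_iff_not_dvd Nat.prime_two).2 hM)
  · rw [hp.primeFactors, Finset.prod_singleton] at hμ
    exact bk_main k k a b c r s t hk hp le_rfl
      (fun M hM => (Nat.Prime.coprime_iff_not_dvd hp).2 hM) ha hbc hakb hr hs ht h1 h2 h3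
      N μ lam hN hμ hlam
end

section
/- Let k ≥ 3 be a prime with k ≥ 5, and let 1 < a < b < c be integers with a^k < b < c. Then a^k·b + 1, a^k·c + 1 and b·c + 1 cannot all be perfect k-th powers; that is, there is no k-th power Diophantine triple {a^k, b, c} for prime k ≥ 5. -/
open Finset

/-- divided difference bound -/
lemma dd_zero {ι : Type*} [DecidableEq ι] (s : Finset ι) (v : ι → ℝ) (hv : Set.InjOn v s)
    (hs : 2 ≤ #s) : ∑ i ∈ s, (∏ j ∈ s.erase i, (v i - v j))⁻¹ = 0 := by
  have h := Lagrange.coeff_eq_sum (s := s) (v := v) hv (P := (1 : Polynomial ℝ)) (by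
    rw [Polynomial.degree_one]; exact_mod_cast (by omega : 0 < #s))
  rw [Polynomial.coeff_one, if_neg (by omega)] at h
  rw [h]
  simp

lemma dd_bound {ι : Type*} [DecidableEq ι] (m : ℕ) : ∀ (s : Finset ι) (v : ι → ℝ)
    (_ : Set.InjOn v s) (_ : #s = m + 1) (a : ℝ) (_ : ∀ i ∈ s, a ≤ v i) (t : ℝ) (_ : 0 ≤ t),
    0 ≤ (-1) ^ m * ∑ i ∈ s, Real.exp (-(v i - a) * t) * (∏ j ∈ s.erase i, (v i - v j))⁻¹ ∧
    (-1) ^ m * ∑ i ∈ s, Real.exp (-(v i - a) * t) * (∏ j ∈ s.erase i, (v i - v j))⁻¹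
      ≤ t ^ m / (m.factorial : ℝ) := by
  induction m with
  | zero =>
    intro s v hv hs a ha t ht
    obtain ⟨i, rfl⟩ := Finset.card_eq_one.mp hs
    have := ha i (by simp)
    simp
    constructor
    · positivity
    · nlinarith
  | succ m ih =>
    -- first for `a = v i₀`, the minimum
    have key : ∀ (s : Finset ι) (v : ι → ℝ) (_ : Set.InjOn v s) (_ : #s = m + 1 + 1) (i₀ : ι)
      (_ : i₀ ∈ s) (_ : ∀ i ∈ s, v i₀ ≤ v i) (t : ℝ) (_ : 0 ≤ t),
      0 ≤ (-1) ^ (m+1) * ∑ i ∈ s, Real.exp (-(v i - v i₀) * t) * (∏ j ∈ s.erase i, (v i - v j))⁻¹ ∧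
      (-1) ^ (m+1) * ∑ i ∈ s, Real.exp (-(v i - v i₀) * t) * (∏ j ∈ s.erase i, (v i - v j))⁻¹
      ≤ t ^ (m+1) / ((m+1).factorial : ℝ) := by
      intro s v hv hs i₀ hi₀ hmin t ht
      set f : ℝ → ℝ := fun t => (-1) ^ (m+1) * ∑ i ∈ s, Real.exp (-(v i - v i₀) * t) * (∏ j ∈ s.erase i, (v i - v j))⁻¹ with hf
      set g : ℝ → ℝ := fun t => (-1) ^ m * ∑ i ∈ s.erase i₀, Real.exp (-(v i - v i₀) * t) * (∏ j ∈ (s.erase i₀).erase i, (v i - v j))⁻¹ with hg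
      have hg1 : ∀ t, 0 ≤ t → 0 ≤ g t ∧ g t ≤ t ^ m / (m.factorial : ℝ) := by
        intro t ht
        exact ih (s.erase i₀) v (hv.mono (by simp)) (by rw [card_erase_of_mem hi₀, hs]; rfl)
          (v i₀) (fun i hi => hmin i (mem_of_mem_erase hi)) t ht
      have hd : ∀ t, HasDerivAt f (g t) t := by
        intro t
        have h1 : HasDerivAt f ((-1) ^ (m+1) * ∑ i ∈ s, (Real.exp (-(v i - v i₀) * t) * (-(v i - v i₀))) * (∏ j ∈ s.erase i, (v i - v j))⁻¹) t := by
          apply HasDerivAt.const_mul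
          apply HasDerivAt.fun_sum
          intro i hi
          apply HasDerivAt.mul_const
          have := (hasDerivAt_id t).const_mul (-(v i - v i₀))
          simpa using this.exp
        convert h1 using 1
        rw [hg]
        simp only
        rw [← Finset.add_sum_erase s _ hi₀]
        simp only [sub_self, neg_zero, mul_zero, zero_mul, zero_add]
        rw [pow_succ, mul_assoc, Finset.mul_sum (s := s.erase i₀) (a := (-1:ℝ))]
        congr 1
        apply Finset.sum_congr rfl
        intro i hi
        have hi1 := mem_of_mem_erase hi
        have hi2 := ne_of_mem_erase hi
        have hne : v i - v i₀ ≠ 0 := sub_ne_zero.mpr (fun h => hi2 (hv hi1 hi₀ h))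
        rw [← Finset.mul_prod_erase (s.erase i) _ (mem_erase.mpr ⟨hi2.symm, hi₀⟩), mul_inv,
          Finset.erase_right_comm]
        field_simp
      have hf0 : f 0 = 0 := by
        simp only [hf, mul_zero, Real.exp_zero, one_mul]
        rw [dd_zero s v hv (by omega), mul_zero]
      have hfd : Differentiable ℝ f := fun t => (hd t).differentiableAt
      constructor
      · have : MonotoneOn f (Set.Ici 0) := by
          apply monotoneOn_of_deriv_nonneg (convex_Ici 0) hfd.continuous.continuousOn
            hfd.differentiableOn
          intro x hx
          rw [interior_Ici] at hx
          rw [(hd x).deriv]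
          exact (hg1 x (le_of_lt hx)).1
        have := this (Set.mem_Ici.mpr le_rfl) (Set.mem_Ici.mpr ht) ht
        rwa [hf0] at this
      · have hP : ∀ t : ℝ, HasDerivAt (fun t : ℝ => t ^ (m+1) / ((m+1).factorial : ℝ) - f t)
            (t ^ m / (m.factorial : ℝ) - g t) t := by
          intro t
          refine HasDerivAt.sub ?_ (hd t)
          have := (hasDerivAt_pow (m+1) t).div_const ((m+1).factorial : ℝ)
          have e : (((m+1 : ℕ) : ℝ) * t ^ (m + 1 - 1) / ((m+1).factorial : ℝ)) = t ^ m / (m.factorial : ℝ) := by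
            rw [Nat.factorial_succ]
            push_cast
            have : (m.factorial : ℝ) ≠ 0 := by positivity
            have : (m : ℝ) + 1 ≠ 0 := by positivity
            field_simp
          rw [e] at this
          exact this
        have hPd : Differentiable ℝ (fun t : ℝ => t ^ (m+1) / ((m+1).factorial : ℝ) - f t) :=
          fun t => (hP t).differentiableAt
        have : MonotoneOn (fun t : ℝ => t ^ (m+1) / ((m+1).factorial : ℝ) - f t) (Set.Ici 0) := by
          apply monotoneOn_of_deriv_nonneg (convex_Ici 0) hPd.continuous.continuousOn
            hPd.differentiableOn
          intro x hx
          rw [interior_Ici] at hx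
          rw [(hP x).deriv]
          linarith [(hg1 x (le_of_lt hx)).2]
        have := this (Set.mem_Ici.mpr le_rfl) (Set.mem_Ici.mpr ht) ht
        simp only [hf0] at this
        simp at this
        exact this
    intro s v hv hs a ha t ht
    obtain ⟨i₀, hi₀, hmin⟩ := Finset.exists_min_image s v (by rw [← card_pos]; omega)
    obtain ⟨h1, h2⟩ := key s v hv hs i₀ hi₀ hmin t ht
    have e : ∑ i ∈ s, Real.exp (-(v i - a) * t) * (∏ j ∈ s.erase i, (v i - v j))⁻¹
      = Real.exp (-(v i₀ - a) * t) * ∑ i ∈ s, Real.exp (-(v i - v i₀) * t) * (∏ j ∈ s.erase i, (v i - v j))⁻¹ := by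
      rw [Finset.mul_sum]
      apply Finset.sum_congr rfl
      intro i hi
      rw [← mul_assoc, ← Real.exp_add]
      ring_nf
    rw [e, mul_left_comm]
    have h3 : Real.exp (-(v i₀ - a) * t) ≤ 1 := by
      rw [Real.exp_le_one_iff]
      nlinarith [ha i₀ hi₀]
    have h4 := Real.exp_pos (-(v i₀ - a) * t)
    constructor
    · positivity
    · nlinarith

/-- r! divides k^r times product of AP -/
lemma ap_dvd (k : ℕ) (hk : k.Prime) (r : ℕ) (c : ℤ) :
    ((r.factorial : ℕ) : ℤ) ∣ (k : ℤ) ^ r * ∏ s ∈ range r, ((k : ℤ) * s + c) := by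
  have := Fact.mk hk
  obtain ⟨v, m, hm, hr⟩ := Nat.exists_eq_pow_mul_and_not_dvd (Nat.factorial_ne_zero r) k hk.ne_one
  have hvr : v ≤ r := by
    have h1 : padicValNat k r.factorial = v := by
      rw [hr, padicValNat.mul (by have := hk.pos; positivity) (by rintro rfl; simp at hm),
        padicValNat.prime_pow, padicValNat.eq_zero_of_not_dvd hm, add_zero]
    have h2 := sub_one_mul_padicValNat_factorial (p := k) r
    rw [h1] at h2
    have := hk.two_le
    calc v ≤ (k-1) * v := Nat.le_mul_of_pos_left _ (by omega)
      _ ≤ r := by omega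
  have hcop : IsCoprime (k : ℤ) (m : ℤ) := by
    rw [Nat.isCoprime_iff_coprime]
    exact (hk.coprime_iff_not_dvd).2 hm
  obtain ⟨u, w, huw⟩ := hcop
  have hdiv : (m : ℤ) ∣ ∏ s ∈ range r, ((k : ℤ) * s + c) := by
    have h1 : (∏ s ∈ range r, ((k : ℤ) * s + c)) ≡ ∏ s ∈ range r, ((k : ℤ) * (s + u * c)) [ZMOD m] := by
      apply Int.ModEq.prod
      intro s _
      rw [Int.modEq_iff_dvd]
      exact ⟨- w * c, by linear_combination (c) * huw⟩
    rw [Finset.prod_mul_distrib] at h1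
    have h2 : (m : ℤ) ∣ ∏ s ∈ range r, ((s : ℤ) + u * c) := by
      have h3 : ((r.factorial : ℕ) : ℤ) ∣ ∏ s ∈ range r, ((s : ℤ) + u * c) := by
        have := Nat.factorial_coe_dvd_prod r (u * c)
        simpa only [add_comm] using this
      refine dvd_trans ?_ h3
      rw [hr]; push_cast; exact dvd_mul_left _ _
    exact (Int.ModEq.dvd_iff h1).2 (dvd_mul_of_dvd_right h2 _)
  rw [hr]
  push_cast
  exact mul_dvd_mul (pow_dvd_pow _ hvr) hdiv

noncomputable def UU (k i : ℕ) : ℝ := ∏ s ∈ range i, ((k : ℝ) * (s + 1) + 1)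
noncomputable def VV (k i : ℕ) : ℝ := ∏ s ∈ range i, ((k : ℝ) * (s + 1) - 1)
noncomputable def cc (k i d : ℕ) : ℝ :=
  (k : ℝ) ^ (i + d) * UU k (i + d) * VV k (i + d) /
    ((i.factorial : ℝ) * (d.factorial : ℝ) * UU k i * VV k d)

lemma UU_pos (k i : ℕ) : 0 < UU k i := by
  unfold UU
  exact Finset.prod_pos fun s _ => by positivity

lemma VV_pos (k i : ℕ) (hk : 2 ≤ k) : 0 < VV k i := by
  unfold VV
  refine Finset.prod_pos fun s _ => ?_
  have : (2 : ℝ) ≤ k := by exact_mod_cast hk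
  nlinarith [(Nat.cast_nonneg s : (0 : ℝ) ≤ s)]

lemma UU_add (k i d : ℕ) : UU k (i + d) =
    UU k i * ∏ s ∈ range d, ((k : ℝ) * s + (k * (i + 1) + 1)) := by
  unfold UU
  rw [Finset.prod_range_add]
  congr 1
  apply Finset.prod_congr rfl
  intro s _
  push_cast
  ring

lemma VV_add (k i d : ℕ) : VV k (i + d) =
    VV k d * ∏ s ∈ range i, ((k : ℝ) * s + (k * (d + 1) - 1)) := by
  unfold VV
  rw [add_comm, Finset.prod_range_add]
  congr 1
  apply Finset.prod_congr rfl
  intro s _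
  push_cast
  ring

lemma prod_le_asc (k r j : ℕ) (f : ℕ → ℝ) (h0 : ∀ s ∈ range r, 0 ≤ f s)
    (h : ∀ s ∈ range r, f s ≤ (k : ℝ) * (j + 1 + s)) :
    ∏ s ∈ range r, f s ≤ (k : ℝ) ^ r * (r.factorial * (j + r).choose r : ℕ) := by
  calc ∏ s ∈ range r, f s ≤ ∏ s ∈ range r, (k : ℝ) * (j + 1 + s) := Finset.prod_le_prod h0 h
    _ = (k : ℝ) ^ r * (r.factorial * (j + r).choose r : ℕ) := by
      rw [Finset.prod_mul_distrib, ← Nat.ascFactorial_eq_factorial_mul_choose,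
        Nat.ascFactorial_eq_prod_range]
      simp

lemma cc_eq (k i d : ℕ) (hk : 2 ≤ k) : cc k i d =
    ((k : ℝ) ^ d * (∏ s ∈ range d, ((k : ℝ) * s + (k * (i + 1) + 1))) / (d.factorial : ℝ)) *
    ((k : ℝ) ^ i * (∏ s ∈ range i, ((k : ℝ) * s + (k * (d + 1) - 1))) / (i.factorial : ℝ)) := by
  unfold cc
  rw [UU_add, VV_add]
  have h1 := (UU_pos k i).ne'
  have h2 := (VV_pos k d hk).ne'
  have h3 : (d.factorial : ℝ) ≠ 0 := by positivity
  have h4 : (i.factorial : ℝ) ≠ 0 := by positivity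
  rw [pow_add]
  field_simp

lemma cc_int (k i d : ℕ) (hk : k.Prime) : ∃ b : ℤ, (b : ℝ) = cc k i d := by
  rw [cc_eq k i d hk.two_le]
  obtain ⟨p, hp⟩ := ap_dvd k hk d ((k : ℤ) * (i + 1) + 1)
  obtain ⟨q, hq⟩ := ap_dvd k hk i ((k : ℤ) * (d + 1) - 1)
  have hp' := congrArg (Int.cast : ℤ → ℝ) hp
  have hq' := congrArg (Int.cast : ℤ → ℝ) hq
  push_cast at hp' hq'
  rw [hp', hq']
  refine ⟨p * q, ?_⟩
  have h3 : (d.factorial : ℝ) ≠ 0 := by positivity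
  have h4 : (i.factorial : ℝ) ≠ 0 := by positivity
  push_cast
  field_simp

lemma cc_pos (k i d : ℕ) (hk : 2 ≤ k) : 0 < cc k i d := by
  unfold cc
  have h1 := (UU_pos k i)
  have h2 := (VV_pos k d hk)
  have h3 := (UU_pos k (i+d))
  have h4 := (VV_pos k (i+d) hk)
  have : 0 < k := by omega
  positivity

lemma cc_le (k i d : ℕ) (hk : 2 ≤ k) :
    cc k i d ≤ (k : ℝ) ^ (2 * (i + d)) * 2 ^ (i + d + 1) * ((i + d).choose i : ℝ) := by
  rw [cc_eq k i d hk]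
  have hk' : (2 : ℝ) ≤ k := by exact_mod_cast hk
  have h1 := prod_le_asc k d (i+1) (fun s => ((k : ℝ) * s + (k * (i + 1) + 1)))
    (fun s _ => by positivity) (fun s _ => by push_cast; nlinarith)
  have h2 := prod_le_asc k i d (fun s => ((k : ℝ) * s + (k * (d + 1) - 1)))
    (fun s _ => by
      have : (0:ℝ) ≤ k * s := by positivity
      have : (0:ℝ) ≤ k * d := by positivity
      nlinarith) (fun s _ => by nlinarith)
  have h0 : 0 ≤ ∏ s ∈ range i, ((k : ℝ) * s + (k * (d + 1) - 1)) := 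
    Finset.prod_nonneg (fun s _ => by
      have : (0:ℝ) ≤ k * s := by positivity
      have : (0:ℝ) ≤ k * d := by positivity
      nlinarith)
  have h3 : (0:ℝ) < (d.factorial : ℝ) := by positivity
  have h4 : (0:ℝ) < (i.factorial : ℝ) := by positivity
  have h5 : ((i + 1 + d).choose d : ℝ) ≤ 2 ^ (i + d + 1) := by
    have := Nat.choose_le_two_pow (i+1+d) d
    have e : i + 1 + d = i + d + 1 := by ring
    rw [e] at this ⊢
    exact_mod_cast this
  calc _ ≤ ((k : ℝ) ^ d * ((k : ℝ) ^ d * (d.factorial * (i + 1 + d).choose d : ℕ)) / (d.factorial : ℝ)) *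
    ((k : ℝ) ^ i * ((k : ℝ) ^ i * (i.factorial * (d + i).choose i : ℕ)) / (i.factorial : ℝ)) := by
        gcongr
    _ = (k : ℝ) ^ (2 * (i + d)) * ((i + 1 + d).choose d : ℝ) * ((i + d).choose i : ℝ) := by
        rw [add_comm d i]
        push_cast
        field_simp
        ring
    _ ≤ _ := by gcongr

lemma prod_split (i d : ℕ) (g : ℕ → ℝ) : ∏ j ∈ range (i + d + 1), g j =
    (∏ s ∈ range i, g (i - 1 - s)) * g i * ∏ s ∈ range d, g (i + 1 + s) := by
  have : i + d + 1 = (i + 1) + d := by ring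
  rw [this, Finset.prod_range_add, Finset.prod_range_succ, Finset.prod_range_reflect g i]

lemma prod_split_erase (i d : ℕ) (g : ℕ → ℝ) : ∏ j ∈ (range (i + d + 1)).erase i, g j =
    (∏ s ∈ range i, g (i - 1 - s)) * ∏ s ∈ range d, g (i + 1 + s) := by
  have h : ∏ j ∈ (range (i + d + 1)).erase i, g j =
      ∏ j ∈ range (i + d + 1), (Function.update g i 1) j := by
    rw [← Finset.prod_erase (range (i + d + 1)) (f := Function.update g i 1) (a := i) (by simp)]
    apply Finset.prod_congr rfl
    intro j hj
    rw [Function.update_of_ne (ne_of_mem_erase hj)]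
  rw [h, prod_split]
  simp only [Function.update_self, mul_one]
  congr 1
  · apply Finset.prod_congr rfl
    intro s hs
    rw [Function.update_of_ne]
    have := mem_range.mp hs
    omega
  · apply Finset.prod_congr rfl
    intro s hs
    rw [Function.update_of_ne]
    omega

lemma cast_aux (i s : ℕ) (h : s ∈ range i) : ((i - 1 - s : ℕ) : ℝ) = i - 1 - s := by
  have := mem_range.mp h
  rw [Nat.sub_sub, Nat.cast_sub (by omega)]
  push_cast
  ring

lemma prodA (k i d : ℕ) : ∏ j ∈ (range (i + d + 1)).erase i, ((k : ℝ) * i - k * j) =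
    (-1) ^ d * (k : ℝ) ^ (i + d) * i.factorial * d.factorial := by
  rw [prod_split_erase]
  have h1 : ∏ s ∈ range i, ((k : ℝ) * i - k * ((i - 1 - s : ℕ) : ℝ)) = (k : ℝ) ^ i * i.factorial := by
    rw [← Finset.prod_range_add_one_eq_factorial]
    push_cast
    rw [← Finset.card_range i, ← Finset.prod_const, Finset.card_range, ← Finset.prod_mul_distrib]
    apply Finset.prod_congr rfl
    intro s hs
    rw [cast_aux i s hs]; ring
  have h2 : ∏ s ∈ range d, ((k : ℝ) * i - k * ((i + 1 + s : ℕ) : ℝ)) = (-k : ℝ) ^ d * d.factorial := by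
    rw [← Finset.prod_range_add_one_eq_factorial]
    push_cast
    rw [← Finset.card_range d, ← Finset.prod_const, Finset.card_range, ← Finset.prod_mul_distrib]
    apply Finset.prod_congr rfl
    intro s hs
    ring
  rw [h1, h2, neg_pow, pow_add]
  ring

lemma prodB (k i d : ℕ) : ∏ j ∈ range (i + d + 1), ((k : ℝ) * i + 1 - k * j) =
    (-1) ^ d * UU k i * VV k d := by
  rw [prod_split]
  have h1 : ∏ s ∈ range i, ((k : ℝ) * i + 1 - k * ((i - 1 - s : ℕ) : ℝ)) = UU k i := by
    apply Finset.prod_congr rfl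
    intro s hs
    rw [cast_aux i s hs]; ring
  have h2 : ∏ s ∈ range d, ((k : ℝ) * i + 1 - k * ((i + 1 + s : ℕ) : ℝ)) = (-1 : ℝ) ^ d * VV k d := by
    unfold VV
    rw [← Finset.card_range d, ← Finset.prod_const, Finset.card_range, ← Finset.prod_mul_distrib]
    apply Finset.prod_congr rfl
    intro s hs
    push_cast
    ring
  rw [h1, h2]
  ring

lemma prodC (k i d : ℕ) : ∏ j ∈ range (i + d + 1), ((k : ℝ) * i - (k * j + 1)) =
    - ((-1) ^ d * VV k i * UU k d) := by
  rw [prod_split]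
  have h1 : ∏ s ∈ range i, ((k : ℝ) * i - (k * ((i - 1 - s : ℕ) : ℝ) + 1)) = VV k i := by
    apply Finset.prod_congr rfl
    intro s hs
    rw [cast_aux i s hs]; ring
  have h2 : ∏ s ∈ range d, ((k : ℝ) * i - (k * ((i + 1 + s : ℕ) : ℝ) + 1)) = (-1 : ℝ) ^ d * UU k d := by
    unfold UU
    rw [← Finset.card_range d, ← Finset.prod_const, Finset.card_range, ← Finset.prod_mul_distrib]
    apply Finset.prod_congr rfl
    intro s hs
    push_cast
    ring
  rw [h1, h2]
  ring

noncomputable def NN (k n : ℕ) : ℝ := (k : ℝ) ^ (2 * n) * UU k n * VV k n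
noncomputable def QQ (k n : ℕ) (T : ℝ) : ℝ := ∑ i ∈ range (n + 1), cc k i (n - i) * T ^ i
noncomputable def PP (k n : ℕ) (T : ℝ) : ℝ := ∑ i ∈ range (n + 1), cc k (n - i) i * T ^ i

def vv (k : ℕ) : ℕ ⊕ ℕ → ℝ := Sum.elim (fun j => (k : ℝ) * j) (fun j => (k : ℝ) * j + 1)

lemma vv_inj (k : ℕ) (hk : 2 ≤ k) : Function.Injective (vv k) := by
  have key : ∀ a b : ℕ, k * a ≠ k * b + 1 := by
    intro a b h
    have h1 : k ∣ k * b + 1 := ⟨a, h.symm⟩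
    have h2 : k ∣ 1 := (Nat.dvd_add_right (dvd_mul_right k b)).mp h1
    have := Nat.le_of_dvd one_pos h2
    omega
  rintro (a | a) (b | b) h <;> simp only [vv, Sum.elim_inl, Sum.elim_inr] at h
  · have h' : k * a = k * b := by exact_mod_cast h
    rw [Nat.eq_of_mul_eq_mul_left (by omega) h']
  · exact absurd (by exact_mod_cast h) (key a b)
  · exact absurd (by exact_mod_cast h.symm) (key b a)
  · have h' : k * a + 1 = k * b + 1 := by exact_mod_cast h
    rw [Nat.eq_of_mul_eq_mul_left (by omega) (Nat.succ.inj h')]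

lemma erase_inl (s t : Finset ℕ) (i : ℕ) :
    (s.disjSum t).erase (Sum.inl i) = (s.erase i).disjSum t := by
  ext (x | x) <;> simp

lemma erase_inr (s t : Finset ℕ) (i : ℕ) :
    (s.disjSum t).erase (Sum.inr i) = s.disjSum (t.erase i) := by
  ext (x | x) <;> simp

lemma weight_inr (k n i : ℕ) (hk : 2 ≤ k) (hi : i ≤ n) :
    NN k n * (∏ j ∈ ((range (n+1)).disjSum (range (n+1))).erase (Sum.inr i),
      (vv k (Sum.inr i) - vv k j))⁻¹ = cc k i (n - i) := by
  obtain ⟨d, rfl⟩ := Nat.exists_eq_add_of_le hi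
  rw [erase_inr, Finset.prod_disjSum]
  simp only [vv, Sum.elim_inl, Sum.elim_inr, add_sub_add_right_eq_sub]
  rw [prodA, prodB, Nat.add_sub_cancel_left]
  unfold NN cc
  have h1 := (UU_pos k i).ne'
  have h2 := (VV_pos k d hk).ne'
  have h3 : (d.factorial : ℝ) ≠ 0 := by positivity
  have h4 : (i.factorial : ℝ) ≠ 0 := by positivity
  have h5 : (k : ℝ) ≠ 0 := by positivity
  have h6 : ((-1 : ℝ) ^ d) * (-1) ^ d = 1 := by rw [← mul_pow]; simp
  have e : (-1) ^ d * UU k i * VV k d * ((-1) ^ d * (k : ℝ) ^ (i + d) * i.factorial * d.factorial)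
    = UU k i * VV k d * ((k : ℝ) ^ (i + d) * i.factorial * d.factorial) := by
    linear_combination (UU k i * VV k d * ((k : ℝ) ^ (i + d) * i.factorial * d.factorial)) * h6
  rw [e, two_mul, pow_add _ (i+d) (i+d)]
  field_simp

lemma weight_inl (k n i : ℕ) (hk : 2 ≤ k) (hi : i ≤ n) :
    NN k n * (∏ j ∈ ((range (n+1)).disjSum (range (n+1))).erase (Sum.inl i),
      (vv k (Sum.inl i) - vv k j))⁻¹ = - cc k (n - i) i := by
  obtain ⟨d, rfl⟩ := Nat.exists_eq_add_of_le hi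
  rw [erase_inl, Finset.prod_disjSum]
  simp only [vv, Sum.elim_inl, Sum.elim_inr]
  rw [prodA, prodC, Nat.add_sub_cancel_left]
  unfold NN cc
  rw [add_comm d i]
  have h1 := (UU_pos k d).ne'
  have h2 := (VV_pos k i hk).ne'
  have h3 : (d.factorial : ℝ) ≠ 0 := by positivity
  have h4 : (i.factorial : ℝ) ≠ 0 := by positivity
  have h5 : (k : ℝ) ≠ 0 := by positivity
  have h6 : ((-1 : ℝ) ^ d) * (-1) ^ d = 1 := by rw [← mul_pow]; simp
  have e : ((-1) ^ d * (k : ℝ) ^ (i + d) * i.factorial * d.factorial) * -((-1) ^ d * VV k i * UU k d)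
    = - (VV k i * UU k d * ((k : ℝ) ^ (i + d) * i.factorial * d.factorial)) := by
    linear_combination (-(VV k i * UU k d * ((k : ℝ) ^ (i + d) * i.factorial * d.factorial))) * h6
  rw [e, two_mul, pow_add _ (i+d) (i+d)]
  field_simp

lemma NN_pos (k n : ℕ) (hk : 2 ≤ k) : 0 < NN k n := by
  unfold NN
  have h1 := (UU_pos k n)
  have h2 := (VV_pos k n hk)
  have : 0 < k := by omega
  positivity

lemma pade (k n : ℕ) (hk : 2 ≤ k) (X : ℝ) (hX0 : 0 < X) (hX1 : X ≤ 1) :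
    0 ≤ PP k n (X ^ k) - X * QQ k n (X ^ k) ∧
    PP k n (X ^ k) - X * QQ k n (X ^ k) ≤
      NN k n * ((- Real.log X) ^ (2 * n + 1) / ((2 * n + 1).factorial : ℝ)) := by
  have hL : 0 ≤ - Real.log X := by
    have := Real.log_nonpos hX0.le hX1
    linarith
  have h := dd_bound (2*n+1) ((range (n+1)).disjSum (range (n+1))) (vv k) ((vv_inj k hk).injOn)
    (by rw [Finset.card_disjSum, card_range]; ring) 0
    (by rintro (i | i) _ <;> simp only [vv, Sum.elim_inl, Sum.elim_inr] <;> positivity)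
    (- Real.log X) hL
  have e : NN k n * ((-1) ^ (2 * n + 1) * ∑ i ∈ (range (n+1)).disjSum (range (n+1)),
      Real.exp (-(vv k i - 0) * (- Real.log X)) *
        (∏ j ∈ ((range (n+1)).disjSum (range (n+1))).erase i, (vv k i - vv k j))⁻¹)
      = PP k n (X ^ k) - X * QQ k n (X ^ k) := by
    rw [Finset.sum_disjSum]
    have hs : ((-1 : ℝ)) ^ (2 * n + 1) = -1 := by rw [pow_succ, pow_mul]; simp
    rw [hs]
    have e1 : ∀ i : ℕ, Real.exp (-(vv k (Sum.inl i) - 0) * (- Real.log X)) = (X ^ k) ^ i := by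
      intro i
      simp only [vv, Sum.elim_inl]
      rw [← pow_mul, ← Real.exp_log (pow_pos hX0 _), Real.log_pow]
      congr 1
      push_cast
      ring
    have e2 : ∀ i : ℕ, Real.exp (-(vv k (Sum.inr i) - 0) * (- Real.log X)) = X * (X ^ k) ^ i := by
      intro i
      simp only [vv, Sum.elim_inr]
      rw [← pow_mul, ← pow_succ', ← Real.exp_log (pow_pos hX0 _), Real.log_pow]
      congr 1
      push_cast
      ring
    simp only [e1, e2]
    unfold PP QQ
    rw [neg_one_mul, neg_add, mul_add, mul_neg, mul_neg, Finset.mul_sum, Finset.mul_sum,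
      Finset.mul_sum, sub_eq_add_neg, ← Finset.sum_neg_distrib, ← Finset.sum_neg_distrib]
    congr 1
    · apply Finset.sum_congr rfl
      intro i hi
      have := weight_inl k n i hk (by have := mem_range.mp hi; omega)
      linear_combination (-(X^k)^i) * this
    · rw [← Finset.sum_neg_distrib]
      apply Finset.sum_congr rfl
      intro i hi
      have := weight_inr k n i hk (by have := mem_range.mp hi; omega)
      linear_combination (-X*(X^k)^i) * this
  rw [← e]
  have hN := NN_pos k n hk
  exact ⟨mul_nonneg hN.le h.1, mul_le_mul_of_nonneg_left h.2 hN.le⟩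

lemma QQ_le (k n : ℕ) (hk : 2 ≤ k) (T : ℝ) (hT0 : 0 ≤ T) (hT1 : T ≤ 1) :
    QQ k n T ≤ 2 * (4 * (k : ℝ) ^ 2) ^ n := by
  unfold QQ
  calc _ ≤ ∑ i ∈ range (n + 1), (k : ℝ) ^ (2 * n) * 2 ^ (n + 1) * (n.choose i : ℝ) := by
        apply Finset.sum_le_sum
        intro i hi
        have hi' : i + (n - i) = n := by have := mem_range.mp hi; omega
        have h1 := cc_le k i (n - i) hk
        rw [hi'] at h1
        have h2 := (cc_pos k i (n - i) hk).le
        have h3 : T ^ i ≤ 1 := pow_le_one₀ hT0 hT1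
        nlinarith
    _ = 2 * (4 * (k : ℝ) ^ 2) ^ n := by
        rw [← Finset.mul_sum]
        have : ∑ i ∈ range (n + 1), (n.choose i : ℝ) = 2 ^ n := by
          exact_mod_cast Nat.sum_range_choose n
        rw [this, mul_pow, ← pow_mul, pow_succ, show (4 : ℝ) = 2 * 2 by norm_num, mul_pow]
        ring

lemma QQ_pos (k n : ℕ) (hk : 2 ≤ k) (T : ℝ) (hT0 : 0 < T) : 0 < QQ k n T := by
  unfold QQ
  apply Finset.sum_pos
  · intro i _
    have := cc_pos k i (n - i) hk
    positivity
  · simp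

lemma NN_le (k n : ℕ) (hk : 2 ≤ k) :
    NN k n ≤ (k : ℝ) ^ (4 * n) * ((2 * n + 1).factorial : ℝ) := by
  have hk' : (2 : ℝ) ≤ k := by exact_mod_cast hk
  have h1 := prod_le_asc k n 1 (fun s => ((k : ℝ) * (s + 1) + 1))
    (fun s _ => by positivity) (fun s _ => by push_cast; nlinarith)
  have h2 := prod_le_asc k n 0 (fun s => ((k : ℝ) * (s + 1) - 1))
    (fun s _ => by
      have : (0:ℝ) ≤ k * s := by positivity
      nlinarith) (fun s _ => by push_cast; nlinarith)
  have h0 := (VV_pos k n hk).le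
  unfold NN
  unfold VV at *
  unfold UU
  have h3 : n.factorial * (1 + n).choose n * (n.factorial * (0 + n).choose n) ≤ (2 * n + 1).factorial := by
    have h4 := Nat.le_of_dvd (Nat.factorial_pos _) (Nat.factorial_mul_factorial_dvd_factorial_add n (n+1))
    have e1 : (1 + n).choose n = n + 1 := by rw [add_comm]; exact Nat.choose_succ_self_right n
    have e2 : (0 + n).choose n = 1 := by simp
    rw [e1, e2]
    rw [Nat.factorial_succ] at h4
    have e3 : n + (n + 1) = 2 * n + 1 := by ring
    rw [e3] at h4
    calc _ = n.factorial * ((n + 1) * n.factorial) := by ring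
      _ ≤ _ := h4
  have h3' : ((n.factorial * (1 + n).choose n : ℕ) : ℝ) * ((n.factorial * (0 + n).choose n : ℕ) : ℝ)
    ≤ ((2 * n + 1).factorial : ℝ) := by exact_mod_cast h3
  calc _ ≤ (k : ℝ) ^ (2 * n) * ((k : ℝ) ^ n * (n.factorial * (1 + n).choose n : ℕ)) *
        ((k : ℝ) ^ n * (n.factorial * (0 + n).choose n : ℕ)) := by gcongr
    _ = (k : ℝ) ^ (4 * n) * (((n.factorial * (1 + n).choose n : ℕ) : ℝ) * ((n.factorial * (0 + n).choose n : ℕ) : ℝ)) := by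
      ring
    _ ≤ _ := by gcongr

lemma sum_int (n : ℕ) (f : ℕ → ℝ) (hf : ∀ i, ∃ b : ℤ, (b : ℝ) = f i) (G : ℤ) (hG : (G : ℝ) ≠ 0) :
    ∃ p : ℤ, (p : ℝ) = (G : ℝ) ^ n * ∑ i ∈ range (n + 1), f i * (((G : ℝ) - 1) / G) ^ i := by
  choose b hb using hf
  refine ⟨∑ i ∈ range (n + 1), b i * (G - 1) ^ i * G ^ (n - i), ?_⟩
  push_cast
  rw [Finset.mul_sum]
  apply Finset.sum_congr rfl
  intro i hi
  obtain ⟨d, rfl⟩ := Nat.exists_eq_add_of_le (show i ≤ n by have := mem_range.mp hi; omega)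
  rw [hb, Nat.add_sub_cancel_left, div_pow, pow_add]
  field_simp

set_option maxHeartbeats 1000000 in
lemma approx (k : ℕ) (hkp : k.Prime) (hk5 : 5 ≤ k) (x y W : ℤ) (hx : 5 ≤ x) (hy : 0 < y) (hW : 0 < W)
    (h1 : W ^ k < (x ^ k - 1) * y ^ k) (h2 : (x ^ k - 1) * y ^ k - W ^ k ≤ x ^ k) (n : ℕ) :
    (1 : ℝ) ≤ x * y * (((x : ℝ) ^ k) ^ n * (k : ℝ) ^ (4 * n) * (1 / (k * ((x : ℝ) ^ k - 1))) ^ (2 * n + 1))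
      + x * y * ((x : ℝ) ^ k) ^ n * (2 * (4 * (k : ℝ) ^ 2) ^ n) * (2 / (y : ℝ) ^ k) := by
  have hk2 : 2 ≤ k := by omega
  have hk0 : k ≠ 0 := by omega
  have hxR : (5 : ℝ) ≤ x := by exact_mod_cast hx
  have hyR : (0 : ℝ) < y := by exact_mod_cast hy
  have hWR : (0 : ℝ) < W := by exact_mod_cast hW
  have hkR : (0 : ℝ) < k := by exact_mod_cast (by omega : 0 < k)
  have hx0 : (0:ℝ) < x := by linarith
  have h1R : (W : ℝ) ^ k < ((x : ℝ) ^ k - 1) * (y : ℝ) ^ k := by exact_mod_cast h1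
  have h2R : ((x : ℝ) ^ k - 1) * (y : ℝ) ^ k - (W : ℝ) ^ k ≤ (x : ℝ) ^ k := by exact_mod_cast h2
  have hG5 : (5 : ℝ) ≤ (x : ℝ) ^ k := le_trans hxR (le_self_pow₀ (by linarith) hk0)
  set G : ℝ := (x : ℝ) ^ k with hG
  set T : ℝ := (G - 1) / G with hT
  have hG0 : 0 < G := by linarith
  have hT0 : 0 < T := div_pos (by linarith) hG0
  have hT1 : T ≤ 1 := by rw [hT, div_le_one hG0]; linarith
  have hThalf : 1 / 2 ≤ T := by rw [hT, le_div_iff₀ hG0]; linarith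
  obtain ⟨X, hX0, hXk⟩ : ∃ X : ℝ, 0 < X ∧ X ^ k = T :=
    ⟨T ^ ((k : ℝ)⁻¹), Real.rpow_pos_of_pos hT0 _, Real.rpow_inv_natCast_pow hT0.le hk0⟩
  have hX1 : X ≤ 1 := by
    by_contra hcon
    push Not at hcon
    have := one_lt_pow₀ hcon hk0
    linarith
  set w : ℝ := W / (x * y) with hw
  have hw0 : 0 < w := by positivity
  have hxy : (0:ℝ) < x * y := by positivity
  have hwk : w ^ k = (W : ℝ) ^ k / (G * (y : ℝ) ^ k) := by rw [hw, div_pow, mul_pow]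
  have hyk : (0:ℝ) < (y : ℝ) ^ k := by positivity
  have hwX : w < X := by
    apply lt_of_pow_lt_pow_left₀ k hX0.le
    rw [hXk, hwk, hT, div_lt_div_iff₀ (by positivity) hG0]
    nlinarith
  have hdiff : X ^ k - w ^ k ≤ 1 / (y : ℝ) ^ k := by
    have e : X ^ k - w ^ k = ((G - 1) * (y : ℝ) ^ k - (W : ℝ) ^ k) / (G * (y : ℝ) ^ k) := by
      rw [hXk, hwk, hT]; field_simp
    rw [e, div_le_div_iff₀ (by positivity) hyk]
    nlinarith
  have hδ : X - w ≤ 2 / (y : ℝ) ^ k := by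
    obtain ⟨l, rfl⟩ : ∃ l, k = l + 1 := ⟨k - 1, by omega⟩
    have a1 : w ^ l ≤ X ^ l := pow_le_pow_left₀ hw0.le hwX.le l
    have a2 : (X - w) * X ^ l ≤ X ^ (l+1) - w ^ (l+1) := by
      rw [pow_succ, pow_succ]
      nlinarith
    have a3 : 1 / 2 ≤ X ^ l := by
      have : X ^ (l + 1) ≤ X ^ l := pow_le_pow_of_le_one hX0.le hX1 (by omega)
      linarith
    have a4 : (X - w) * (1 / 2) ≤ (X - w) * X ^ l := by
      apply mul_le_mul_of_nonneg_left a3; linarith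
    have a5 : 2 / (y : ℝ) ^ (l+1) = 2 * (1 / (y : ℝ) ^ (l+1)) := by ring
    rw [a5]
    linarith
  obtain ⟨b1, b2⟩ := pade k n hk2 X hX0 hX1
  rw [hXk] at b1 b2
  have hQ0 := QQ_pos k n hk2 T hT0
  have hQ1 := QQ_le k n hk2 T hT0.le hT1
  have hL : - Real.log X ≤ 1 / (k * (G - 1)) := by
    have c1 : (k : ℝ) * Real.log X = Real.log T := by rw [← hXk, Real.log_pow]
    have c2 : - Real.log T ≤ 1 / (G - 1) := by
      rw [← Real.log_inv]
      have := Real.log_le_sub_one_of_pos (inv_pos.mpr hT0)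
      have e : T⁻¹ - 1 = 1 / (G - 1) := by
        have : G - 1 ≠ 0 := by linarith
        rw [hT]; field_simp; ring
      linarith
    rw [← div_div, le_div_iff₀ (by linarith)] at *
    rw [le_div_iff₀ hkR]
    nlinarith
  have hL0 : 0 ≤ - Real.log X := by
    have := Real.log_nonpos hX0.le hX1
    linarith
  have hE : PP k n T - X * QQ k n T ≤ (k : ℝ) ^ (4 * n) * (1 / (k * (G - 1))) ^ (2 * n + 1) := by
    refine b2.trans ?_
    have hf : (0:ℝ) < ((2 * n + 1).factorial : ℝ) := by positivity
    calc _ ≤ ((k : ℝ) ^ (4 * n) * ((2 * n + 1).factorial : ℝ)) * ((1 / (k * (G - 1))) ^ (2 * n + 1) / ((2 * n + 1).factorial : ℝ)) := by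
          have := NN_le k n hk2
          gcongr
      _ = _ := by field_simp
  have hGZ : ((x ^ k : ℤ) : ℝ) = G := by push_cast; rfl
  obtain ⟨p, hp⟩ := sum_int n (fun i => cc k (n - i) i) (fun i => cc_int k (n-i) i hkp) (x ^ k) (by rw [hGZ]; exact hG0.ne')
  obtain ⟨q, hq⟩ := sum_int n (fun i => cc k i (n - i)) (fun i => cc_int k i (n-i) hkp) (x ^ k) (by rw [hGZ]; exact hG0.ne')
  rw [hGZ] at hp hq
  have hp' : (p : ℝ) = G ^ n * PP k n T := hp
  have hq' : (q : ℝ) = G ^ n * QQ k n T := hq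
  have hint : ((p * (x * y) - q * W : ℤ) : ℝ) = x * y * G ^ n * (PP k n T - w * QQ k n T) := by
    push_cast
    rw [hp', hq', hw]
    field_simp
  have hGn : 0 < G ^ n := by positivity
  have hpos : 0 < PP k n T - w * QQ k n T := by
    have d3 : 0 < (X - w) * QQ k n T := mul_pos (by linarith) hQ0
    have d2 : PP k n T - w * QQ k n T = (PP k n T - X * QQ k n T) + (X - w) * QQ k n T := by ring
    rw [d2]
    linarith
  have hone : (1 : ℝ) ≤ ((p * (x * y) - q * W : ℤ) : ℝ) := by
    have : (0 : ℝ) < ((p * (x * y) - q * W : ℤ) : ℝ) := by rw [hint]; positivity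
    have : 0 < (p * (x * y) - q * W : ℤ) := by exact_mod_cast this
    exact_mod_cast this
  rw [hint] at hone
  have hfin : PP k n T - w * QQ k n T ≤ (k : ℝ) ^ (4 * n) * (1 / (k * (G - 1))) ^ (2 * n + 1)
      + (2 * (4 * (k : ℝ) ^ 2) ^ n) * (2 / (y : ℝ) ^ k) := by
    have d1 : (X - w) * QQ k n T ≤ (2 / (y : ℝ) ^ k) * (2 * (4 * (k : ℝ) ^ 2) ^ n) := by
      gcongr
    have d2 : PP k n T - w * QQ k n T = (PP k n T - X * QQ k n T) + (X - w) * QQ k n T := by ring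
    rw [d2, mul_comm (2 * (4 * (k : ℝ) ^ 2) ^ n)]
    exact add_le_add hE d1
  calc (1 : ℝ) ≤ _ := hone
    _ ≤ x * y * G ^ n * ((k : ℝ) ^ (4 * n) * (1 / (k * (G - 1))) ^ (2 * n + 1)
      + (2 * (4 * (k : ℝ) ^ 2) ^ n) * (2 / (y : ℝ) ^ k)) := by gcongr
    _ = _ := by ring

lemma final_contra (x y G κ : ℝ) (hx : 5 ≤ x) (hy : x < y) (hκ : 25 ≤ κ) (hG1 : 5 * κ ^ 2 ≤ G)
    (hG2 : x ^ 5 ≤ G)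
    (h : ∀ n : ℕ, 1 ≤ x * y / G * (2 * κ / G) ^ n + 4 * x * (4 * κ * G) ^ n / y ^ 4) : False := by
  have hx0 : 0 < x := by linarith
  have hy0 : 0 < y := by linarith
  have hκ0 : 0 < κ := by linarith
  have hG0 : 0 < G := lt_of_lt_of_le (by positivity) hG1
  have hh0 : 0 < 2 * κ / G := by positivity
  have hh1 : 2 * κ / G < 1 := by rw [div_lt_one hG0]; nlinarith
  have hex : ∃ n : ℕ, x * y / G * (2 * κ / G) ^ n < 1 / 2 := by
    obtain ⟨n, hn⟩ := exists_pow_lt_of_lt_one (show 0 < 1 / 2 / (x * y / G) by positivity) hh1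
    refine ⟨n, ?_⟩
    rw [lt_div_iff₀ (by positivity)] at hn
    linarith
  classical
  have hn := Nat.find_spec hex
  have hmin := fun m => Nat.find_min hex (m := m)
  set n := Nat.find hex
  have h1 : y ^ 4 < 8 * x * (4 * κ * G) ^ n := by
    have h2 : 1 / 2 < 4 * x * (4 * κ * G) ^ n / y ^ 4 := by linarith [h n]
    rw [lt_div_iff₀ (by positivity)] at h2
    linarith
  rcases hnm : n with _ | m
  · rw [hnm, pow_zero] at h1
    have h3 : x ^ 3 ≤ y ^ 3 := by gcongr
    have h4 : (5:ℝ) ^ 3 ≤ x ^ 3 := by gcongr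
    have : y ^ 4 = y * y ^ 3 := by ring
    nlinarith
  · have h3 := hmin m (by omega)
    push Not at h3
    rw [hnm] at h1
    have h4 : G / (2 * x) * (G / (2 * κ)) ^ m ≤ y := by
      have e : (G / (2 * κ)) ^ m * (2 * κ / G) ^ m = 1 := by
        rw [← mul_pow, show G / (2 * κ) * (2 * κ / G) = 1 by field_simp, one_pow]
      have h5 : (1/2) * (G / x * (G / (2 * κ)) ^ m) ≤ (x * y / G * (2 * κ / G) ^ m) * (G / x * (G / (2 * κ)) ^ m) := by
        gcongr
      have e2 : (x * y / G * (2 * κ / G) ^ m) * (G / x * (G / (2 * κ)) ^ m) = y := by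
        have : (x * y / G * (2 * κ / G) ^ m) * (G / x * (G / (2 * κ)) ^ m) = y * ((x / x) * (G / G)) * ((G / (2 * κ)) ^ m * (2 * κ / G) ^ m) := by ring
        rw [this, e, div_self hx0.ne', div_self hG0.ne']; ring
      rw [e2] at h5
      have e3 : (1/2) * (G / x * (G / (2 * κ)) ^ m) = G / (2 * x) * (G / (2 * κ)) ^ m := by
        field_simp
      linarith
    have h5 : (G / (2 * x) * (G / (2 * κ)) ^ m) ^ 4 ≤ y ^ 4 := by gcongr
    have hG3 : 25 * κ ^ 4 ≤ G ^ 2 := by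
      have : (5 * κ ^ 2) ^ 2 ≤ G ^ 2 := by gcongr
      nlinarith
    have hκ3 : 25 ^ 3 ≤ κ ^ 3 := by gcongr
    have h6 : 4 * κ * G ≤ (G / (2 * κ)) ^ 4 := by
      rw [div_pow, le_div_iff₀ (by positivity)]
      have a1 : 25 * κ ^ 4 * (5 * κ ^ 2) ≤ G ^ 2 * G := by gcongr
      have a2 : 64 * κ ^ 5 ≤ 25 * κ ^ 4 * (5 * κ ^ 2) := by
        have : 0 < κ ^ 5 := by positivity
        nlinarith
      calc 4 * κ * G * (2 * κ) ^ 4 = 64 * κ ^ 5 * G := by ring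
        _ ≤ (G ^ 2 * G) * G := mul_le_mul_of_nonneg_right (a2.trans a1) hG0.le
        _ = G ^ 4 := by ring
    have h7 : 32 * x * κ * G ≤ (G / (2 * x)) ^ 4 := by
      rw [div_pow, le_div_iff₀ (by positivity)]
      have a1 : 512 * κ ≤ G ^ 2 := by
        have : 25 * κ ^ 4 = 25 * κ ^ 3 * κ := by ring
        nlinarith
      calc 32 * x * κ * G * (2 * x) ^ 4 = x ^ 5 * (512 * κ) * G := by ring
        _ ≤ G * G ^ 2 * G := by gcongr
        _ = G ^ 4 := by ring
    have h8 : (32 * x * κ * G) * (4 * κ * G) ^ m ≤ (G / (2 * x) * (G / (2 * κ)) ^ m) ^ 4 := by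
      calc _ ≤ (G / (2 * x)) ^ 4 * ((G / (2 * κ)) ^ 4) ^ m := by gcongr
        _ = _ := by rw [mul_pow, ← pow_mul, ← pow_mul, mul_comm 4 m]
    have e : 8 * x * (4 * κ * G) ^ (m+1) = (32 * x * κ * G) * (4 * κ * G) ^ m := by
      rw [pow_succ]; ring
    linarith

lemma five_pow (k : ℕ) (hk : 5 ≤ k) : 5 * (k : ℝ) ^ 4 ≤ 5 ^ k := by
  induction k, hk using Nat.le_induction with
  | base => norm_num
  | succ k hk ih =>
    have hk' : (5 : ℝ) ≤ k := by exact_mod_cast hk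
    rw [pow_succ (5 : ℝ) k]
    push_cast
    have h1 : ((k : ℝ) + 1) ≤ k * (6/5) := by linarith
    have h2 : ((k : ℝ) + 1) ^ 4 ≤ (k * (6/5)) ^ 4 := by gcongr
    have h3 : (0:ℝ) ≤ (k:ℝ) ^ 4 := by positivity
    rw [mul_pow] at h2
    norm_num at h2
    linarith

lemma no_approx (k : ℕ) (hkp : k.Prime) (hk5 : 5 ≤ k) (x y W : ℤ) (hx : 5 ≤ x) (hxy : x < y)
    (hW : 0 < W)
    (h1 : W ^ k < (x ^ k - 1) * y ^ k) (h2 : (x ^ k - 1) * y ^ k - W ^ k ≤ x ^ k) : False := by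
  have hxR : (5 : ℝ) ≤ x := by exact_mod_cast hx
  have hkR : (5 : ℝ) ≤ k := by exact_mod_cast hk5
  have hxyR : (x : ℝ) < y := by exact_mod_cast hxy
  have hG1 : 5 * ((k : ℝ) ^ 2) ^ 2 ≤ (x : ℝ) ^ k := by
    calc 5 * ((k : ℝ) ^ 2) ^ 2 = 5 * (k : ℝ) ^ 4 := by ring
      _ ≤ 5 ^ k := five_pow k hk5
      _ ≤ _ := by gcongr
  have hG2 : (x : ℝ) ^ 5 ≤ (x : ℝ) ^ k := pow_le_pow_right₀ (by linarith) hk5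
  have hκ : (25 : ℝ) ≤ (k : ℝ) ^ 2 := by nlinarith
  refine final_contra x y ((x : ℝ) ^ k) ((k : ℝ) ^ 2) hxR hxyR hκ hG1 hG2 ?_
  intro n
  have h := approx k hkp hk5 x y W hx (by omega) hW h1 h2 n
  have hx0 : (0 : ℝ) < x := by linarith
  have hy0 : (0 : ℝ) < y := by linarith
  have hy1 : (1 : ℝ) ≤ y := by linarith
  have hk0 : (0 : ℝ) < k := by linarith
  set G : ℝ := (x : ℝ) ^ k with hG
  have hG5 : 5 ≤ G := by nlinarith
  have hG0 : 0 < G := by linarith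
  refine h.trans (add_le_add ?_ ?_)
  · have e : G ^ n * (k : ℝ) ^ (4 * n) * (1 / (k * (G - 1))) ^ (2 * n + 1)
      = (1 / (k * (G - 1))) * (G * (k : ℝ) ^ 4 * (1 / (k * (G - 1))) ^ 2) ^ n := by
      rw [pow_succ, mul_pow, mul_pow, pow_mul, pow_mul]; ring
    rw [e]
    have g1 : 0 < G - 1 := by linarith
    have a1 : 1 / (k * (G - 1)) ≤ 1 / G := by
      apply one_div_le_one_div_of_le hG0; nlinarith
    have a2 : G * (k : ℝ) ^ 4 * (1 / (k * (G - 1))) ^ 2 ≤ 2 * (k : ℝ) ^ 2 / G := by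
      have e2 : G * (k : ℝ) ^ 4 * (1 / (k * (G - 1))) ^ 2 = G * (k : ℝ) ^ 2 / (G - 1) ^ 2 := by
        field_simp
      rw [e2, div_le_div_iff₀ (by positivity) hG0]
      have : G * G ≤ 2 * (G - 1) ^ 2 := by nlinarith
      nlinarith
    calc _ ≤ (x : ℝ) * y * ((1 / G) * (2 * (k : ℝ) ^ 2 / G) ^ n) := by gcongr
      _ = _ := by ring
  · have a3 : (y : ℝ) ^ 5 ≤ (y : ℝ) ^ k := pow_le_pow_right₀ hy1 hk5
    calc _ ≤ (x : ℝ) * y * G ^ n * (2 * (4 * (k : ℝ) ^ 2) ^ n) * (2 / (y : ℝ) ^ 5) := by gcongr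
      _ = _ := by
        rw [mul_pow (4 * (k : ℝ) ^ 2) G]
        field_simp
        ring

/-- There are no `k`-th power Diophantine triples of the form `{a^k, b, c}`
for `k ≥ 5` prime and `1 < a < b < c` with `a^k < b < c`. -/
theorem no_kth_power_diophantine_triple_prime_ge_five
    (k : ℕ) (a b c : ℤ) (hkp : Nat.Prime k) (hk5 : 5 ≤ k)
    (ha : 1 < a) (hab : a < b) (hbc : b < c) (hakb : a ^ k < b) :
    ¬ ∃ r s t : ℤ, 0 < r ∧ 0 < s ∧ 0 < t ∧
      a ^ k * b + 1 = r ^ k ∧ a ^ k * c + 1 = s ^ k ∧ b * c + 1 = t ^ k := by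
  rintro ⟨r, s, t, hr, hs, ht, h1, h2, h3⟩
  have hak : 0 < a ^ k := by positivity
  have hrk : a ^ k * a ^ k + 1 < r ^ k := by nlinarith
  have hrs : r < s := by
    apply lt_of_pow_lt_pow_left₀ k hs.le
    nlinarith
  have hr5 : 5 ≤ r := by
    have h4 : a ^ 2 < r := by
      apply lt_of_pow_lt_pow_left₀ k hr.le
      have e : (a ^ 2) ^ k = a ^ k * a ^ k := by rw [← pow_mul, two_mul, pow_add]
      rw [e]
      linarith
    nlinarith
  have e : (a ^ 2 * t) ^ k = a ^ k * a ^ k * t ^ k := by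
    rw [mul_pow, ← pow_mul, two_mul, pow_add]
  have key : (r ^ k - 1) * s ^ k - (a ^ 2 * t) ^ k = r ^ k - 1 - a ^ k * a ^ k := by
    rw [e, ← h1, ← h2, ← h3]
    ring
  have hpos : 0 < a ^ k * a ^ k := by positivity
  exact no_approx k hkp hk5 r s (a ^ 2 * t) hr5 hrs (by positivity) (by linarith) (by linarith)
end

section
/- Let 1 < a < b < c be integers with a^4 < b < c such that a^4·b + 1 = r^4, a^4·c + 1 = s^4, and b·c + 1 = t^4 for positive integers r, s, t, and set z := r·s − a^2·t (a positive integer). Then 4·(r·s)^3·z + 4·r·s·z^3 + 1 + a^8 = r^4 + s^4 + 6·(r·s·z)^2 + z^4. -/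
/-- For a 4-th power Diophantine triple `{a⁴, b, c}` with `z := rs - a²t`,
one has `4(rs)³z + 4rsz³ + 1 + a⁸ = r⁴ + s⁴ + 6(rsz)² + z⁴`. -/
theorem rsz_identity
    (a b c r s t z : ℤ)
    (ha : 1 < a) (hab : a < b) (hbc : b < c) (hakb : a ^ 4 < b)
    (hr : 0 < r) (hs : 0 < s) (ht : 0 < t)
    (h1 : a ^ 4 * b + 1 = r ^ 4) (h2 : a ^ 4 * c + 1 = s ^ 4)
    (h3 : b * c + 1 = t ^ 4) (hz : z = r * s - a ^ 2 * t) :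
    4 * (r * s) ^ 3 * z + 4 * r * s * z ^ 3 + 1 + a ^ 8 =
      r ^ 4 + s ^ 4 + 6 * (r * s * z) ^ 2 + z ^ 4 := by
  have e : (r * s - z) ^ 4 = (r ^ 4 - 1) * (s ^ 4 - 1) + a ^ 8 := by
    rw [← h1, ← h2, hz]
    linear_combination (-a ^ 8) * h3
  linear_combination -e
end

section
/- Let k ≥ 3 and 1 < a < b < c be integers with a^k < b < c such that a^k·b + 1 = r^k, a^k·c + 1 = s^k, and b·c + 1 = t^k for positive integers r, s, t. Then |(r^k − 1)^{1/k} − (a^2·t)/s| < (r^k − 2)^{1/k}/(k·s^k), where the k-th roots are the real positive ones. -/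
/-- For a `k`-th power Diophantine triple `{a^k, b, c}`, one has
`|(r^k - 1)^{1/k} - a² t / s| < (r^k - 2)^{1/k} / (k s^k)`. -/
theorem kth_root_approx_upper_bound
    (k : ℕ) (a b c r s t : ℤ) (hk : 3 ≤ k)
    (ha : 1 < a) (hab : a < b) (hbc : b < c) (hakb : a ^ k < b)
    (hr : 0 < r) (hs : 0 < s) (ht : 0 < t)
    (h1 : a ^ k * b + 1 = r ^ k) (h2 : a ^ k * c + 1 = s ^ k)
    (h3 : b * c + 1 = t ^ k) :
    |((r : ℝ) ^ k - 1) ^ ((1 : ℝ) / k) - (a : ℝ) ^ 2 * t / s| <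
      ((r : ℝ) ^ k - 2) ^ ((1 : ℝ) / k) / ((k : ℝ) * (s : ℝ) ^ k) := by
  have hk0 : k ≠ 0 := by omega
  have hkR : (0 : ℝ) < k := by exact_mod_cast (by omega : 0 < k)
  have h1' : (a : ℝ) ^ k * b + 1 = (r : ℝ) ^ k := by exact_mod_cast h1
  have h2' : (a : ℝ) ^ k * c + 1 = (s : ℝ) ^ k := by exact_mod_cast h2
  have h3' : (b : ℝ) * c + 1 = (t : ℝ) ^ k := by exact_mod_cast h3
  have hA : (1 : ℝ) < (a : ℝ) ^ k := one_lt_pow₀ (by exact_mod_cast ha) hk0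
  have hAb : (a : ℝ) ^ k < b := by exact_mod_cast hakb
  have hbc' : (b : ℝ) < c := by exact_mod_cast hbc
  have ha' : (0 : ℝ) < a := by exact_mod_cast (by omega : 0 < a)
  have hs' : (0 : ℝ) < s := by exact_mod_cast hs
  have ht' : (0 : ℝ) < t := by exact_mod_cast ht
  have hS : (0 : ℝ) < (s : ℝ) ^ k := pow_pos hs' k
  have hY : (0 : ℝ) < (a : ℝ) ^ 2 * t / s := by positivity
  have hYk : ((a : ℝ) ^ 2 * t / s) ^ k = ((a : ℝ) ^ k) ^ 2 * (t : ℝ) ^ k / (s : ℝ) ^ k := by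
    rw [div_pow, mul_pow]; ring
  have hP : (1 : ℝ) < (a : ℝ) ^ k * b - 0 := by nlinarith
  have hP1 : (0 : ℝ) < (a : ℝ) ^ k * b - 1 := by linarith
  rw [← h1']
  have e1 : (a : ℝ) ^ k * b + 1 - 1 = (a : ℝ) ^ k * b := by ring
  have e2 : (a : ℝ) ^ k * b + 1 - 2 = (a : ℝ) ^ k * b - 1 := by ring
  rw [e1, e2]
  have hXk : (((a : ℝ) ^ k * b) ^ ((1 : ℝ) / k)) ^ k = (a : ℝ) ^ k * b := by
    rw [one_div]; exact Real.rpow_inv_natCast_pow (by linarith) hk0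
  have hZk : (((a : ℝ) ^ k * b - 1) ^ ((1 : ℝ) / k)) ^ k = (a : ℝ) ^ k * b - 1 := by
    rw [one_div]; exact Real.rpow_inv_natCast_pow hP1.le hk0
  have hX : 0 < ((a : ℝ) ^ k * b) ^ ((1 : ℝ) / k) := Real.rpow_pos_of_pos (by linarith) _
  have hZ : 0 < ((a : ℝ) ^ k * b - 1) ^ ((1 : ℝ) / k) := Real.rpow_pos_of_pos hP1 _
  rw [← h3'] at hYk
  generalize ((a : ℝ) ^ k * b) ^ ((1 : ℝ) / k) = X at *
  generalize ((a : ℝ) ^ k * b - 1) ^ ((1 : ℝ) / k) = Z at *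
  generalize (a : ℝ) ^ 2 * t / s = Y at *
  generalize (s : ℝ) ^ k = S at *
  generalize (a : ℝ) ^ k = A at *
  -- the key identity
  have hdiff : X ^ k - Y ^ k = A * (b - A) / S := by
    rw [hXk, hYk, ← h2']; rw [← h2'] at hS; field_simp; ring
  have hYX : Y < X := by
    refine lt_of_pow_lt_pow_left₀ k hX.le ?_
    have : 0 < A * (b - A) / S := div_pos (mul_pos (by linarith) (by linarith)) hS
    linarith
  have hZY : Z < Y := by
    refine lt_of_pow_lt_pow_left₀ k hY.le ?_
    have : A * (b - A) / S < 1 := by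
      rw [div_lt_one hS]; nlinarith
    linarith
  rw [abs_of_pos (sub_pos.mpr hYX)]
  by_contra hcon
  push Not at hcon
  have hB := one_add_mul_le_pow (a := (X - Y) / Y)
    (by have : 0 < (X - Y) / Y := div_pos (sub_pos.mpr hYX) hY
        linarith) k
  have e3 : 1 + (X - Y) / Y = X / Y := by field_simp; ring
  rw [e3, div_pow, le_div_iff₀ (pow_pos hY k)] at hB
  obtain ⟨n, rfl⟩ : ∃ n, k = n + 1 := ⟨k - 1, by omega⟩
  have e4 : (1 + ((n + 1 : ℕ) : ℝ) * ((X - Y) / Y)) * Y ^ (n + 1)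
      = Y ^ (n + 1) + ((n + 1 : ℕ) : ℝ) * (X - Y) * Y ^ n := by
    field_simp
    ring
  rw [e4] at hB
  rw [div_le_iff₀ (by positivity)] at hcon
  have hdS : (X ^ (n + 1) - Y ^ (n + 1)) * S = A * (b - A) := by
    rw [hdiff]; field_simp
  have hpow : Z ^ n ≤ Y ^ n := pow_le_pow_left₀ hZ.le hZY.le n
  have i1 : Z ^ (n + 1) ≤ Y ^ n * Z := by
    rw [pow_succ]; exact mul_le_mul_of_nonneg_right hpow hZ.le
  have i2 : Y ^ n * Z ≤ Y ^ n * ((X - Y) * (((n + 1 : ℕ) : ℝ) * S)) :=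
    mul_le_mul_of_nonneg_left hcon (pow_pos hY n).le
  have i3 : ((n + 1 : ℕ) : ℝ) * (X - Y) * Y ^ n * S ≤ (X ^ (n + 1) - Y ^ (n + 1)) * S :=
    mul_le_mul_of_nonneg_right (by linarith) hS.le
  have i4 : A * b - 1 ≤ A * (b - A) := by
    rw [← hdS, ← hZk]
    refine i1.trans (i2.trans (le_trans (le_of_eq ?_) i3))
    ring
  nlinarith
end
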